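/- Assume A, C, D and that all functions c_i^ℓ (i ∈ N, ℓ ∈ L_0) are bounded. Then the constrained stochastic game possesses a Nash equilibrium in the set Φ of stationary multi-strategies. -/

import Mathlib

open MeasureTheory ProbabilityTheory Filter Topology
open scoped ENNReal NNReal

namespace CSGame

/-- The joint action space of the players. -/
abbrev JA {n : ℕ} (A : Fin n → Type) : Type := (i : Fin n) → A i

/-- The data of a constrained discounted stochastic Markov game:
countable state space `X`, Borel action spaces `A i` with compact admissible
action sets `As i x`, transition probability `p`, initial distribution `η`,
discount factor `α`, cost/constraint functions `c i ℓ` (`ℓ = 0` is the cost,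
`ℓ ∈ L = {1,…,l}` are the constraints) and constraint bounds `κ i ℓ`. -/
structure GameData (n l : ℕ) (X : Type) (A : Fin n → Type)
    [MeasurableSpace X] [∀ i, MeasurableSpace (A i)] [∀ i, TopologicalSpace (A i)] where
  As : (i : Fin n) → X → Set (A i)
  p : X → JA A → Measure X
  η : Measure X
  α : ℝ
  c : Fin n → Fin (l + 1) → X → JA A → ℝ
  κ : Fin n → Fin (l + 1) → ℝ
  hAs_ne : ∀ i x, (As i x).Nonempty
  hAs_cpt : ∀ i x, IsCompact (As i x)
  hp : ∀ x a, IsProbabilityMeasure (p x a)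
  hpm : ∀ x y, Measurable fun a => p x a {y}
  hη : IsProbabilityMeasure η
  hα0 : 0 < α
  hα1 : α < 1
  hc : ∀ i ℓ x, Measurable (c i ℓ x)

variable {n l : ℕ}
variable {X : Type} [Countable X] [MeasurableSpace X] [DiscreteMeasurableSpace X]
  [TopologicalSpace X] [DiscreteTopology X] [BorelSpace X] [SecondCountableTopology X]
variable {A : Fin n → Type} [∀ i, MeasurableSpace (A i)] [∀ i, TopologicalSpace (A i)]
  [∀ i, PolishSpace (A i)] [∀ i, BorelSpace (A i)]

/-- The set of feasible action profiles in state `x` (the section of `𝕂` at `x`). -/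
def jointSet (G : GameData n l X A) (x : X) : Set (JA A) :=
  Set.univ.pi fun i => G.As i x

/-- Histories of the game: `Hist X AA t` records the initial state and `t`
state-action transitions, ending with the current state (this is `H^{t+1}`). -/
def Hist (X AA : Type) : ℕ → Type
  | 0 => X
  | t + 1 => Hist X AA t × AA × X

noncomputable instance histMS (X AA : Type) [MeasurableSpace X] [MeasurableSpace AA] :
    ∀ t, MeasurableSpace (Hist X AA t)
  | 0 => inferInstanceAs (MeasurableSpace X)
  | t + 1 =>
      letI := histMS X AA t
      inferInstanceAs (MeasurableSpace (Hist X AA t × AA × X))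

/-- The current (last) state of a history. -/
def lastState (X AA : Type) : ∀ t, Hist X AA t → X
  | 0, h => h
  | _ + 1, h => h.2.2

theorem measurable_lastState (X AA : Type) [MeasurableSpace X] [MeasurableSpace AA] :
    ∀ t, Measurable (lastState X AA t)
  | 0 => measurable_id
  | _ + 1 => measurable_snd.comp measurable_snd

variable (G : GameData n l X A)

/-- A (history dependent, randomised) strategy of player `i`: a sequence of
transition probabilities from histories to the action space of player `i`,
concentrated on the admissible action set at the current state. -/
structure Strategy (i : Fin n) where
  f : ∀ t, Hist X (JA A) t → ProbabilityMeasure (A i)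
  meas : ∀ t (s : Set (A i)), MeasurableSet s →
    Measurable fun h => (f t h : Measure (A i)) s
  supp : ∀ t h, f t h (G.As i (lastState X (JA A) t h)) = 1

/-- A stationary strategy of player `i`: a transition probability from states to
actions, concentrated on the admissible action set. -/
def Stat (i : Fin n) : Type :=
  {φ : X → ProbabilityMeasure (A i) // ∀ x, φ x (G.As i x) = 1}

noncomputable instance (i : Fin n) : TopologicalSpace (Stat G i) :=
  inferInstanceAs (TopologicalSpace
    {φ : X → ProbabilityMeasure (A i) // ∀ x, φ x (G.As i x) = 1})

/-- Multi-strategies: one strategy for each player. -/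
abbrev MultiStrategy : Type _ := ∀ i, Strategy G i

/-- Stationary multi-strategies (the set `Φ`). -/
abbrev StatProfile : Type _ := ∀ i, Stat G i

noncomputable instance : TopologicalSpace (StatProfile G) :=
  inferInstanceAs (TopologicalSpace (∀ i, Stat G i))

/-- The strategy induced by a stationary strategy. -/
noncomputable def ofStat (i : Fin n) (φ : Stat G i) : Strategy G i where
  f := fun t h => φ.1 (lastState X (JA A) t h)
  meas := fun t _s _hs =>
    (Measurable.of_discrete (f := fun x => (φ.1 x : Measure (A i)) _s)).comp
      (measurable_lastState X (JA A) t)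
  supp := fun t h => φ.2 _

/-- The multi-strategy induced by a stationary multi-strategy. -/
noncomputable def ofStatAll (φ : StatProfile G) : MultiStrategy G :=
  fun i => ofStat G i (φ i)

/-- `[π_{-i}, σ]` : player `i` deviates to `σ`, the others keep `π`. -/
noncomputable def combine (π : MultiStrategy G) (i : Fin n) (σ : Strategy G i) :
    MultiStrategy G :=
  Function.update π i σ

/-- `[φ_{-i}, γ]` for stationary profiles. -/
noncomputable def updStat (φ : StatProfile G) (i : Fin n) (γ : Stat G i) :
    StatProfile G :=
  Function.update φ i γ

/-- The joint (product) distribution of the players' actions after history `h`. -/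
noncomputable def jointLaw (π : MultiStrategy G) (t : ℕ) (h : Hist X (JA A) t) :
    Measure (JA A) :=
  Measure.pi fun i => ((π i).f t h : Measure (A i))

/-- The distribution of histories of length `t` under the multi-strategy `π`,
the transition probability `G.p` and the initial distribution `η'`
(the finite-dimensional marginals of the Ionescu–Tulcea measure `P^π_{η'}`). -/
noncomputable def histMeas (η' : Measure X) (π : MultiStrategy G) :
    ∀ t, Measure (Hist X (JA A) t)
  | 0 => η'
  | t + 1 =>
      (histMeas η' π t).bind fun h =>
        (jointLaw G π t h).bind fun a =>
          (G.p (lastState X (JA A) t h) a).map fun y =>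
            (show Hist X (JA A) (t + 1) from (h, a, y))

/-- Expected value of `f (x^{t+1}, a^{t+1})` under `π` (states enumerated from `1`
in the paper, from `0` here). -/
noncomputable def stageExp (η' : Measure X) (π : MultiStrategy G) (t : ℕ)
    (f : X → JA A → ℝ) : ℝ :=
  ∫ h, (∫ a, f (lastState X (JA A) t h) a ∂(jointLaw G π t h)) ∂(histMeas G η' π t)

/-- The expected discounted cost functional
`J(π) = (1-α) E^π_{η'} [∑_{t≥1} α^{t-1} f(x^t,a^t)]`. -/
noncomputable def Jfun (η' : Measure X) (f : X → JA A → ℝ) (π : MultiStrategy G) : ℝ :=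
  (1 - G.α) * ∑' t : ℕ, G.α ^ t * stageExp G η' π t f

/-- `J_i^ℓ(π)` of the paper. -/
noncomputable def J (i : Fin n) (ℓ : Fin (l + 1)) (π : MultiStrategy G) : ℝ :=
  Jfun G G.η (G.c i ℓ) π

/-- `π_i ∈ Δ_i(π_{-i})` : all constraints of player `i` are satisfied. -/
def Feas (i : Fin n) (π : MultiStrategy G) : Prop :=
  ∀ ℓ : Fin (l + 1), ℓ ≠ 0 → J G i ℓ π ≤ G.κ i ℓ

/-- Expectation of `w(x^{t+1})` (as an extended nonnegative real). -/
noncomputable def wStateExp (η' : Measure X) (π : MultiStrategy G) (t : ℕ)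
    (w : X → ℝ) : ℝ≥0∞ :=
  ∫⁻ h, ENNReal.ofReal (w (lastState X (JA A) t h)) ∂(histMeas G η' π t)

/-- Assumption A(i): continuity of the transition probability in the actions. -/
def AssumptionA1 : Prop :=
  ∀ x y, ContinuousOn (fun a => G.p x a {y}) (jointSet G x)

/-- Assumption A: continuity of the transition probability and of the
cost/constraint functions in the actions. -/
def AssumptionA : Prop :=
  AssumptionA1 G ∧ ∀ i ℓ x, ContinuousOn (G.c i ℓ x) (jointSet G x)

/-- Assumption B for the weight function `w`: `w ≥ 1` bounds all the costs on `𝕂`,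
the discounted tails `sup_π (1-α) E^π_η[∑_{t≥k} α^{t-1} w(x^t)]` vanish as `k → ∞`,
and for each stage `t` the family `{w(x^t)}` is uniformly integrable over all
multi-strategies. -/
def AssumptionB (w : X → ℝ) : Prop :=
  (∀ x, 1 ≤ w x) ∧
  (∀ i ℓ x a, a ∈ jointSet G x → |G.c i ℓ x a| ≤ w x) ∧
  Tendsto (fun k : ℕ => ⨆ π : MultiStrategy G,
      ENNReal.ofReal (1 - G.α) *
        ∑' t : ℕ, ENNReal.ofReal G.α ^ (k + t) * wStateExp G G.η π (k + t) w)
    atTop (𝓝 0) ∧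
  ∀ t : ℕ, Tendsto (fun k : ℕ => ⨆ π : MultiStrategy G,
      ∫⁻ h in {h | (k : ℝ) ≤ w (lastState X (JA A) t h)},
        ENNReal.ofReal (w (lastState X (JA A) t h)) ∂(histMeas G G.η π t))
    atTop (𝓝 0)

/-- Assumption C (Slater condition). -/
def AssumptionC : Prop :=
  ∀ (φ : StatProfile G) (i : Fin n), ∃ π : Strategy G i,
    ∀ ℓ : Fin (l + 1), ℓ ≠ 0 → J G i ℓ (combine G (ofStatAll G φ) i π) < G.κ i ℓ

/-- Assumption D: the initial distribution charges every state. -/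
def AssumptionD : Prop :=
  ∀ x : X, 0 < G.η {x}

/-- Assumption W (weighted-norm conditions of Wessels). -/
def AssumptionW (w : X → ℝ) : Prop :=
  (∀ x, 1 ≤ w x) ∧
  (∀ i ℓ x a, a ∈ jointSet G x → |G.c i ℓ x a| ≤ w x) ∧
  (∃ δ : ℝ, 1 ≤ δ ∧ δ * G.α < 1 ∧ ∀ x a, a ∈ jointSet G x →
      ∫⁻ y, ENNReal.ofReal (w y) ∂(G.p x a) ≤ ENNReal.ofReal (δ * w x)) ∧
  (∀ x, ContinuousOn (fun a => ∫⁻ y, ENNReal.ofReal (w y) ∂(G.p x a)) (jointSet G x)) ∧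
  (∫⁻ y, ENNReal.ofReal (w y) ∂G.η) < ⊤

/-- All cost and constraint functions are bounded. -/
def BoundedCosts : Prop :=
  ∀ i (ℓ : Fin (l + 1)), ∃ C : ℝ, ∀ x a, |G.c i ℓ x a| ≤ C

/-- A stationary multi-strategy `φ` is a Nash equilibrium of the constrained game:
it is feasible, and no player can lower his discounted cost by a unilateral
deviation to any (history dependent) strategy satisfying his constraints. -/
def IsNashStat (φ : StatProfile G) : Prop :=
  (∀ i, Feas G i (ofStatAll G φ)) ∧
  ∀ (i : Fin n) (σ : Strategy G i), Feas G i (combine G (ofStatAll G φ) i σ) →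
    J G i 0 (ofStatAll G φ) ≤ J G i 0 (combine G (ofStatAll G φ) i σ)

section Occupation

/-- A correlated strategy of the players. -/
structure CorrStrategy where
  f : ∀ t, Hist X (JA A) t → ProbabilityMeasure (JA A)
  meas : ∀ t (s : Set (JA A)), MeasurableSet s →
    Measurable fun h => (f t h : Measure (JA A)) s
  supp : ∀ t h, f t h (jointSet G (lastState X (JA A) t h)) = 1

/-- History distributions under a correlated strategy. -/
noncomputable def histMeasC (π : CorrStrategy G) : ∀ t, Measure (Hist X (JA A) t)
  | 0 => G.η
  | t + 1 =>
      (histMeasC π t).bind fun h =>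
        ((π.f t h : Measure (JA A))).bind fun a =>
          (G.p (lastState X (JA A) t h) a).map fun y =>
            (show Hist X (JA A) (t + 1) from (h, a, y))

/-- The occupation measure `ρ(K') = (1-α) E^π_η [∑_{t≥1} α^{t-1} 1_{K'}(x^t,a^t)]`
of a correlated strategy, as a measure on the state–action pairs. -/
noncomputable def occ (π : CorrStrategy G) : Measure (X × JA A) :=
  ENNReal.ofReal (1 - G.α) •
    Measure.sum fun t : ℕ => ENNReal.ofReal G.α ^ t •
      ((histMeasC G π t).bind fun h =>
        (π.f t h : Measure (JA A)).map fun a => (lastState X (JA A) t h, a))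

/-- The set `𝓜` of occupation measures of correlated strategies. -/
def OccSet : Set (ProbabilityMeasure (X × JA A)) :=
  {ρ | ∃ π : CorrStrategy G, (ρ : Measure (X × JA A)) = occ G π}

/-- Projection of a state–action pair onto the coordinates of player `i`. -/
def projAct (i : Fin n) : X × JA A → X × A i := fun q => (q.1, q.2 i)

/-- The set `𝓜_i` of statewise projections of occupation measures onto `𝕂_i`. -/
def MiSet (i : Fin n) : Set (ProbabilityMeasure (X × A i)) :=
  {μ | ∃ ρ ∈ OccSet G, (μ : Measure (X × A i)) = (ρ : Measure (X × JA A)).map (projAct i)}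

/-- The marginal `μ̂(x) = μ({x} × A_i(x))`. -/
noncomputable def marg (i : Fin n) (μ : ProbabilityMeasure (X × A i)) (x : X) : ℝ≥0∞ :=
  (μ : Measure (X × A i)) ({x} ×ˢ G.As i x)

/-- `μ = μ̂ φ` : `φ` disintegrates `μ`, i.e. `μ({x} × B) = φ(B|x) μ̂(x)`. -/
def Disint (i : Fin n) (μ : ProbabilityMeasure (X × A i)) (φ : Stat G i) : Prop :=
  ∀ x (B : Set (A i)), MeasurableSet B → B ⊆ G.As i x →
    (μ : Measure (X × A i)) ({x} ×ˢ B) = (φ.1 x B : ℝ≥0∞) * marg G i μ x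

/-- The occupation measure on state–action pairs of a multi-strategy. -/
noncomputable def occMulti (η' : Measure X) (π : MultiStrategy G) : Measure (X × JA A) :=
  ENNReal.ofReal (1 - G.α) •
    Measure.sum fun t : ℕ => ENNReal.ofReal G.α ^ t •
      ((histMeas G η' π t).bind fun h =>
        (jointLaw G π t h).map fun a => (lastState X (JA A) t h, a))

end Occupation

section COP

/-- The product distribution on action profiles in state `x` in which player `i`
plays the fixed action `ai` and every player `j ≠ i` plays `φ j`. -/
noncomputable def statJoint (φ : StatProfile G) (i : Fin n) (x : X) (ai : A i) :
    Measure (JA A) :=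
  Measure.pi fun j =>
    if h : j = i then Measure.dirac (cast (congrArg A h.symm) ai)
    else ((φ j).1 x : Measure (A j))

/-- `c_i^ℓ(x, [φ_{-i}(x), a_i])`. -/
noncomputable def cbar (φ : StatProfile G) (i : Fin n) (ℓ : Fin (l + 1)) (x : X)
    (ai : A i) : ℝ :=
  ∫ a, G.c i ℓ x a ∂(statJoint G φ i x ai)

/-- `p(y | x, [φ_{-i}(x), a_i])`. -/
noncomputable def pbar (φ : StatProfile G) (i : Fin n) (y x : X) (ai : A i) : ℝ≥0∞ :=
  ∫⁻ a, G.p x a {y} ∂(statJoint G φ i x ai)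

/-- Feasibility in the constrained optimisation problem `COP(φ_{-i})`:
`μ ∈ Pr(𝕂_i)` satisfies the constraint inequalities and the characteristic
equations of occupation measures. -/
def COPFeasible (φ : StatProfile G) (i : Fin n)
    (μ : ProbabilityMeasure (X × A i)) : Prop :=
  (μ : Measure (X × A i)) {q : X × A i | q.2 ∈ G.As i q.1} = 1 ∧
  (∀ ℓ : Fin (l + 1), ℓ ≠ 0 →
    ∫ q : X × A i, cbar G φ i ℓ q.1 q.2 ∂(μ : Measure (X × A i)) ≤ G.κ i ℓ) ∧
  ∀ x : X, (μ : Measure (X × A i)) ({x} ×ˢ G.As i x) =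
    ENNReal.ofReal (1 - G.α) * G.η {x} +
      ENNReal.ofReal G.α *
        ∫⁻ q : X × A i, pbar G φ i x q.1 q.2 ∂(μ : Measure (X × A i))

/-- The objective of `COP(φ_{-i})`. -/
noncomputable def COPObj (φ : StatProfile G) (i : Fin n)
    (μ : ProbabilityMeasure (X × A i)) : ℝ :=
  ∫ q : X × A i, cbar G φ i 0 q.1 q.2 ∂(μ : Measure (X × A i))

/-- The solution set `𝓞_i(φ_{-i})` of `COP(φ_{-i})`. -/
def COPSol (φ : StatProfile G) (i : Fin n) : Set (ProbabilityMeasure (X × A i)) :=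
  {μ | COPFeasible G φ i μ ∧
    ∀ ν, COPFeasible G φ i ν → COPObj G φ i μ ≤ COPObj G φ i ν}

end COP

section Perturbed

/-- `η̃` is a probability measure charging exactly the `η`-null states `X_0`. -/
def IsPerturb (ηt : Measure X) : Prop :=
  IsProbabilityMeasure ηt ∧ (∀ x, G.η {x} = 0 → 0 < ηt {x}) ∧
    ∀ x, G.η {x} ≠ 0 → ηt {x} = 0

/-- The perturbed initial distribution `η(m) = (1 - 1/m) η + (1/m) η̃`. -/
noncomputable def etam (ηt : Measure X) (m : ℕ) : Measure X :=
  ENNReal.ofReal (1 - 1 / (m : ℝ)) • G.η + ENNReal.ofReal (1 / (m : ℝ)) • ηt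

/-- The truncation `c_i^{ℓ,m}` of `c_i^ℓ` at the level `√m`. -/
noncomputable def ctrunc (i : Fin n) (ℓ : Fin (l + 1)) (m : ℕ) (x : X) (a : JA A) : ℝ :=
  max (-Real.sqrt m) (min (G.c i ℓ x a) (Real.sqrt m))

/-- `J_i^{ℓ,η(m)}`: discounted cost with truncated costs and perturbed initial
distribution. -/
noncomputable def Jm (ηt : Measure X) (m : ℕ) (i : Fin n) (ℓ : Fin (l + 1))
    (π : MultiStrategy G) : ℝ :=
  Jfun G (etam G ηt m) (ctrunc G i ℓ m) π

/-- The perturbed constraint bounds `κ_i^{ℓ,m} = (1 - 1/m) κ_i^ℓ + 1/√m`. -/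
noncomputable def kappam (i : Fin n) (ℓ : Fin (l + 1)) (m : ℕ) : ℝ :=
  (1 - 1 / (m : ℝ)) * G.κ i ℓ + 1 / Real.sqrt m

/-- `π_i ∈ Δ_i^m(π_{-i})` : the constraints of the `m`-CSG hold. -/
def FeasM (ηt : Measure X) (m : ℕ) (i : Fin n) (π : MultiStrategy G) : Prop :=
  ∀ ℓ : Fin (l + 1), ℓ ≠ 0 → Jm G ηt m i ℓ π ≤ kappam G i ℓ m

end Perturbed

end CSGame

namespace ScarfB
open Finset
variable {T I R : Type*} [Fintype T] [DecidableEq T] [Fintype I] [DecidableEq I] [LinearOrder R]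

/-- dominance -/
def Dom (k : I → T → R) (S : Finset (T ⊕ I)) : Prop :=
  ∀ y : T, ∃ i, Sum.inr i ∉ S ∧ ∀ x, Sum.inl x ∈ S → k i y ≤ k i x

theorem card_fact (S : Finset (T ⊕ I)) (hc : S.card + 1 = Fintype.card I) :
    (univ.filter fun i : I => Sum.inr i ∉ S).card = S.toLeft.card + 1 := by
  have h1 : (univ.filter fun i : I => Sum.inr i ∉ S).card + S.toRight.card = Fintype.card I := by
    have : S.toRight = univ.filter fun i : I => Sum.inr i ∈ S := by ext; simp
    rw [this, add_comm, Finset.card_filter_add_card_filter_not]; simp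
  have h2 := S.card_toLeft_add_card_toRight
  omega

theorem door_two (k : I → T → R) (hk : ∀ i, Function.Injective (k i))
    (S : Finset (T ⊕ I)) (hS : Dom k S) (hc : S.card + 1 = Fintype.card I)
    (hne : S.toLeft.Nonempty) :
    ∃ z₁ z₂, z₁ ≠ z₂ ∧ ∀ z, (z ∉ S ∧ Dom k (insert z S)) ↔ (z = z₁ ∨ z = z₂) := by
  classical
  have hmin : ∀ i, ∃ x, Sum.inl x ∈ S ∧ ∀ y, Sum.inl y ∈ S → k i x ≤ k i y := by
    intro i
    obtain ⟨x, hx, h⟩ := Finset.exists_min_image S.toLeft (k i) hne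
    exact ⟨x, by simpa using hx, fun y hy => h y (by simpa using hy)⟩
  choose m hmS hm using hmin
  set D := univ.filter fun i : I => Sum.inr i ∉ S with hD
  have hDc : D.card = S.toLeft.card + 1 := card_fact S hc
  have hmD : ∀ i, i ∈ D ↔ Sum.inr i ∉ S := by intro i; simp [hD]
  have hsurj : ∀ x, Sum.inl x ∈ S → ∃ i ∈ D, m i = x := by
    intro x hx
    obtain ⟨i, hi, h⟩ := hS x
    exact ⟨i, (hmD i).2 hi, hk i (le_antisymm (hm i x hx) (h _ (hmS i)))⟩
  obtain ⟨a, haD, b, hbD, hab, hmab⟩ : ∃ a ∈ D, ∃ b ∈ D, a ≠ b ∧ m a = m b := by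
    apply Finset.exists_ne_map_eq_of_card_lt_of_maps_to (t := S.toLeft)
    · omega
    · intro i _; simpa using hmS i
  -- no subset of D of size < |τ| surjects
  have hns : ∀ E ⊆ D, (∀ x, Sum.inl x ∈ S → ∃ i ∈ E, m i = x) → S.toLeft.card ≤ E.card := by
    intro E _ h
    calc S.toLeft.card ≤ (E.image m).card := by
          apply Finset.card_le_card
          intro x hx
          obtain ⟨i, hi, rfl⟩ := h x (by simpa using hx)
          exact Finset.mem_image_of_mem _ hi
      _ ≤ _ := Finset.card_image_le
  have hcrit : ∀ j ∈ D, (∀ x, Sum.inl x ∈ S → ∃ i ∈ D.erase j, m i = x) → j = a ∨ j = b := by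
    intro j hj h
    by_contra hcon
    push Not at hcon
    have := hns ((D.erase j).erase a) (by grind) (by
      intro x hx
      obtain ⟨i, hi, rfl⟩ := h x hx
      by_cases hia : i = a
      · subst hia; exact ⟨b, by grind, hmab.symm⟩
      · exact ⟨i, by grind, rfl⟩)
    have h1 : a ∈ D.erase j := by grind
    rw [Finset.card_erase_of_mem h1, Finset.card_erase_of_mem hj] at this
    have : 0 < S.toLeft.card := hne.card_pos
    omega
  have hgood : ∀ j, j = a ∨ j = b → ∀ x, Sum.inl x ∈ S → ∃ i ∈ D.erase j, m i = x := by
    intro j hj x hx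
    obtain ⟨i, hi, rfl⟩ := hsurj x hx
    by_cases hij : i = j
    · subst hij
      rcases hj with rfl | rfl
      · exact ⟨b, by grind, hmab.symm⟩
      · exact ⟨a, by grind, hmab⟩
    · exact ⟨i, by grind, rfl⟩
  let Y : I → T → Prop := fun j y => ∀ i ∈ D.erase j, k i (m i) < k i y
  have hstep : ∀ j, ∃ z : T ⊕ I, ((¬ ∃ y, Y j y) ∧ z = Sum.inr j) ∨
      (∃ x, z = Sum.inl x ∧ Y j x ∧ ∀ y, Y j y → k j y ≤ k j x) := by
    intro j
    by_cases h : ∃ y, Y j y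
    · obtain ⟨y, hy⟩ := h
      obtain ⟨x, hx, hx'⟩ := Finset.exists_max_image (univ.filter (Y j)) (k j) ⟨y, by simpa using hy⟩
      exact ⟨Sum.inl x, Or.inr ⟨x, rfl, by simpa using hx, fun y hy => hx' y (by simpa using hy)⟩⟩
    · exact ⟨Sum.inr j, Or.inl ⟨h, rfl⟩⟩
  choose Z hZ using hstep
  have hYj : ∀ j x, Y j x → ∀ i, Sum.inr i ∉ S → (∀ z, Sum.inl z ∈ S → k i x ≤ k i z) → i = j := by
    intro j x hY i hi h
    by_contra hne
    have h1 := hY i (by simp [hne, hmD, hi])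
    exact absurd (h _ (hmS i)) (not_le.2 h1)
  have habD : ∀ j, j = a ∨ j = b → j ∈ D := by rintro j (rfl | rfl) <;> assumption
  have hfwd : ∀ j, j = a ∨ j = b → Z j ∉ S ∧ Dom k (insert (Z j) S) := by
    intro j hj
    rcases hZ j with ⟨hno, hz⟩ | ⟨x, hz, hYx, hmax⟩
    · rw [hz]
      refine ⟨(hmD j).1 (habD j hj), ?_⟩
      intro y
      have : ¬ Y j y := fun h => hno ⟨y, h⟩
      simp only [Y] at this
      push Not at this
      obtain ⟨i, hi, hle⟩ := this
      rw [Finset.mem_erase, hmD] at hi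
      refine ⟨i, by simp [hi.1, hi.2], ?_⟩
      intro x hx
      have hx : Sum.inl x ∈ S := by simpa using hx
      exact hle.trans (hm i x hx)
    · rw [hz]
      refine ⟨?_, ?_⟩
      · intro hx
        obtain ⟨i, hi, rfl⟩ := hgood j hj x hx
        exact lt_irrefl _ (hYx i hi)
      · intro y
        by_cases hy : Y j y
        · refine ⟨j, by simpa using (hmD j).1 (habD j hj), ?_⟩
          intro w hw
          simp only [Finset.mem_insert, Sum.inl.injEq] at hw
          have h1 := hmax y hy
          rcases hw with rfl | hw
          · exact h1
          · obtain ⟨i, hi, h⟩ := hS x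
            have := hYj j x hYx i hi h
            subst this
            exact h1.trans (h w hw)
        · simp only [Y] at hy
          push Not at hy
          obtain ⟨i, hi, hle⟩ := hy
          have hlt := hYx i hi
          rw [Finset.mem_erase, hmD] at hi
          refine ⟨i, by simp [hi.2], ?_⟩
          intro w hw
          simp only [Finset.mem_insert, Sum.inl.injEq] at hw
          rcases hw with rfl | hw
          · exact hle.trans hlt.le
          · exact hle.trans (hm i w hw)
  refine ⟨Z a, Z b, ?_, ?_⟩
  · intro hEq
    rcases hZ a with ⟨_, hz⟩ | ⟨x, hz, hYx, _⟩ <;> rcases hZ b with ⟨_, hz'⟩ | ⟨x', hz', hYx', _⟩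
    · rw [hz, hz'] at hEq; exact hab (Sum.inr.inj hEq)
    · rw [hz, hz'] at hEq; cases hEq
    · rw [hz, hz'] at hEq; cases hEq
    · rw [hz, hz'] at hEq
      have := Sum.inl.inj hEq
      subst this
      obtain ⟨i, hi, h⟩ := hS x
      have h1 := hYj a x hYx i hi h
      have h2 := hYj b x hYx' i hi h
      exact hab (h1.symm.trans h2)
  · intro z
    constructor
    · rintro ⟨hzS, hdom⟩
      rcases z with x | j
      · obtain ⟨j, hj, hjx⟩ := hdom x
        have hjS : Sum.inr j ∉ S := fun h => hj (by simp [h])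
        have hnot : ∀ i, (∀ w, Sum.inl w ∈ S → k i x ≤ k i w) → ∀ w, Sum.inl w ∈ S →
            (∀ v, Sum.inl v ∈ insert (Sum.inl x) S → k i w ≤ k i v) → False := by
          intro i h w hw h'
          have : w = x := hk i (le_antisymm (h' x (by simp)) (h w hw))
          subst this; exact hzS hw
        have hjx' : ∀ w, Sum.inl w ∈ S → k j x ≤ k j w := fun w hw => hjx w (by simp [hw])
        have hsj : ∀ i₀, (∀ w, Sum.inl w ∈ S → k i₀ x ≤ k i₀ w) →
            ∀ w, Sum.inl w ∈ S → ∃ i ∈ (D.erase j).erase i₀, m i = w := by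
          intro i₀ hi₀ w hw
          obtain ⟨i, hi, h⟩ := hdom w
          have hiS : Sum.inr i ∉ S := fun h => hi (by simp [h])
          refine ⟨i, ?_, hk i (le_antisymm (hm i w hw) (h _ (by simp [hmS i])))⟩
          rw [Finset.mem_erase, Finset.mem_erase, hmD]
          refine ⟨?_, ?_, hiS⟩
          · rintro rfl; exact hnot _ hi₀ w hw h
          · rintro rfl; exact hnot _ hjx' w hw h
        have hjab : j = a ∨ j = b := hcrit j ((hmD j).2 hjS) (by
          intro w hw
          obtain ⟨i, hi, h⟩ := hsj j hjx' w hw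
          exact ⟨i, by grind, h⟩)
        have hYx : Y j x := by
          intro i hi
          by_contra hlt
          push Not at hlt
          have h1 := hns ((D.erase j).erase i) (by grind) (hsj i (fun w hw => hlt.trans (hm i w hw)))
          rw [Finset.card_erase_of_mem hi, Finset.card_erase_of_mem ((hmD j).2 hjS)] at h1
          have : 0 < S.toLeft.card := hne.card_pos
          omega
        have : Sum.inl x = Z j := by
          rcases hZ j with ⟨hno, hz⟩ | ⟨x', hz, hYx', hmax⟩
          · exact absurd ⟨x, hYx⟩ hno
          · rw [hz]
            congr 1
            apply hk j
            apply le_antisymm (hmax x hYx)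
            obtain ⟨i, hi, h⟩ := hdom x'
            have hiS : Sum.inr i ∉ S := fun h => hi (by simp [h])
            have := hYj j x' hYx' i hiS (fun z hz => h z (by simp [hz]))
            subst this
            exact h x (by simp)
        rcases hjab with rfl | rfl
        · exact Or.inl this
        · exact Or.inr this
      · have hsub : ∀ w, Sum.inl w ∈ S → ∃ i ∈ D.erase j, m i = w := by
          intro w hw
          obtain ⟨i, hi, h⟩ := hdom w
          have hi' : i ≠ j ∧ Sum.inr i ∉ S := by simpa using hi
          exact ⟨i, by rw [Finset.mem_erase, hmD]; exact hi',
            hk i (le_antisymm (hm i w hw) (h _ (by simp [hmS i])))⟩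
        have hjab := hcrit j ((hmD j).2 hzS) hsub
        have : Sum.inr j = Z j := by
          rcases hZ j with ⟨hno, hz⟩ | ⟨x', hz, hYx', hmax⟩
          · exact hz.symm
          · exfalso
            obtain ⟨i, hi, h⟩ := hdom x'
            have hi' : i ≠ j ∧ Sum.inr i ∉ S := by simpa using hi
            exact hi'.1 (hYj j x' hYx' i hi'.2 (fun z hz => h z (by simp [hz])))
        rcases hjab with rfl | rfl
        · exact Or.inl this
        · exact Or.inr this
    · rintro (rfl | rfl)
      · exact hfwd a (Or.inl rfl)
      · exact hfwd b (Or.inr rfl)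
end ScarfB
namespace ScarfB
open Finset
variable {T I R : Type*} [Fintype T] [DecidableEq T] [Fintype I] [DecidableEq I] [LinearOrder R]

theorem scarf [Nonempty T] [Nonempty I] (k : I → T → R) (hk : ∀ i, Function.Injective (k i))
    (c : T → I) : ∃ S : Finset (T ⊕ I), Dom k S ∧ S.image (Sum.elim c id) = univ := by
  classical
  by_contra hcon
  push Not at hcon
  obtain ⟨i₀⟩ := ‹Nonempty I›
  set c' : T ⊕ I → I := Sum.elim c id with hc'
  set doors : Finset (Finset (T ⊕ I)) := univ.filter fun S => Dom k S ∧ S.card + 1 = Fintype.card I ∧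
    S.image c' = univ.erase i₀ with hdoors
  set rooms : Finset (Finset (T ⊕ I)) := univ.filter fun S => Dom k S ∧ S.card = Fintype.card I
    with hrooms
  have key := Finset.sum_card_bipartiteAbove_eq_sum_card_bipartiteBelow
    (s := doors) (t := rooms) (fun d s => d ⊆ s)
  have hR : Even (∑ s ∈ rooms, (doors.bipartiteBelow (fun d s => d ⊆ s) s).card) := by
    apply Finset.even_sum
    intro s hs
    simp only [hrooms, mem_filter, mem_univ, true_and] at hs
    obtain ⟨hsd, hsc⟩ := hs
    rcases Finset.eq_empty_or_nonempty (doors.bipartiteBelow (fun d s => d ⊆ s) s) with h0 | ⟨d, hd⟩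
    · simp [h0]
    · simp only [Finset.bipartiteBelow, mem_filter, hdoors, mem_univ, true_and] at hd
      obtain ⟨⟨hd1, hd2, hd3⟩, hds⟩ := hd
      obtain ⟨z, hz, rfl⟩ := Finset.exists_eq_insert_iff.2 ⟨hds, by omega⟩
      have hinj : Set.InjOn c' d := by
        apply Finset.card_image_iff.1
        rw [hd3, Finset.card_erase_of_mem (mem_univ _), Finset.card_univ]; omega
      have hzc : c' z ≠ i₀ := by
        intro h
        apply hcon _ hsd
        rw [Finset.image_insert, hd3, h, Finset.insert_erase (mem_univ _)]
      obtain ⟨z', hz'd, hz'⟩ : ∃ z' ∈ d, c' z' = c' z := by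
        have : c' z ∈ d.image c' := by rw [hd3]; simp [hzc]
        simpa using this
      have hzz : z ≠ z' := by rintro rfl; exact hz hz'd
      have : doors.bipartiteBelow (fun d s => d ⊆ s) (insert z d) =
          {d, (insert z d).erase z'} := by
        ext e
        simp only [Finset.bipartiteBelow, mem_filter, hdoors, mem_univ, true_and, mem_insert,
          mem_singleton]
        constructor
        · rintro ⟨⟨he1, he2, he3⟩, hes⟩
          obtain ⟨w, hw, hwe⟩ := Finset.exists_eq_insert_iff.2 ⟨hes, by omega⟩
          have he : e = (insert z d).erase w := by rw [← hwe, Finset.erase_insert hw]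
          have hws : w ∈ insert z d := by rw [← hwe]; simp
          by_cases hwz : w = z
          · left; rw [he, hwz, Finset.erase_insert hz]
          by_cases hwz' : w = z'
          · right; rw [he, hwz']
          exfalso
          have hwd : w ∈ d := by simpa [hwz] using hws
          have : c' w ∈ e.image c' := by
            rw [he3, ← hd3]; exact Finset.mem_image_of_mem _ hwd
          obtain ⟨v, hv, hvw⟩ := Finset.mem_image.1 this
          rw [he, Finset.mem_erase, Finset.mem_insert] at hv
          rcases hv with ⟨hvne, rfl | hv⟩
          · exact hwz' (hinj hwd hz'd (hvw.symm.trans hz'.symm))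
          · exact hvne (hinj hv hwd hvw)
        · rintro (rfl | rfl)
          · exact ⟨⟨hd1, hd2, hd3⟩, hds⟩
          · refine ⟨⟨?_, ?_, ?_⟩, Finset.erase_subset _ _⟩
            · intro y
              obtain ⟨i, hi, h⟩ := hsd y
              exact ⟨i, fun hh => hi (Finset.mem_of_mem_erase hh),
                fun x hx => h x (Finset.mem_of_mem_erase hx)⟩
            · rw [Finset.card_erase_of_mem (by simp [hz'd]), hsc]; omega
            · rw [← hd3]
              ext j
              simp only [mem_image, mem_erase, mem_insert]
              constructor
              · rintro ⟨v, ⟨hv1, rfl | hv⟩, rfl⟩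
                · exact ⟨z', hz'd, hz'⟩
                · exact ⟨v, hv, rfl⟩
              · rintro ⟨v, hv, rfl⟩
                by_cases hvz : v = z'
                · exact ⟨z, ⟨hzz, Or.inl rfl⟩, by rw [hvz, hz']⟩
                · exact ⟨v, ⟨hvz, Or.inr hv⟩, rfl⟩
      rw [this, Finset.card_pair]
      · exact even_two
      · intro h
        have : z ∈ d := by rw [h]; simp [hzz]
        exact hz this
  have hroomsAbove : ∀ d ∈ doors, ∀ s, s ∈ rooms.bipartiteAbove (fun d s => d ⊆ s) d ↔
      ∃ z, z ∉ d ∧ Dom k (insert z d) ∧ insert z d = s := by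
    intro d hd s
    simp only [hdoors, mem_filter, mem_univ, true_and] at hd
    simp only [Finset.bipartiteAbove, mem_filter, hrooms, mem_univ, true_and]
    constructor
    · rintro ⟨⟨h1, h2⟩, h3⟩
      obtain ⟨z, hz, rfl⟩ := Finset.exists_eq_insert_iff.2 ⟨h3, by omega⟩
      exact ⟨z, hz, h1, rfl⟩
    · rintro ⟨z, hz, h1, rfl⟩
      exact ⟨⟨h1, by rw [Finset.card_insert_of_notMem hz]; exact hd.2.1⟩, Finset.subset_insert _ _⟩
  set d₀ : Finset (T ⊕ I) := (univ.erase i₀).image Sum.inr with hd₀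
  have hd0r : ∀ i, Sum.inr i ∈ d₀ ↔ i ≠ i₀ := by intro i; simp [hd₀]
  have hd0l : ∀ x, Sum.inl x ∉ d₀ := by intro x; simp [hd₀]
  have hd0m : d₀ ∈ doors := by
    simp only [hdoors, mem_filter, mem_univ, true_and]
    refine ⟨?_, ?_, ?_⟩
    · intro y
      exact ⟨i₀, by simp [hd0r], fun x hx => absurd hx (hd0l x)⟩
    · rw [hd₀, Finset.card_image_of_injective _ Sum.inr_injective,
        Finset.card_erase_of_mem (mem_univ _), Finset.card_univ]
      have : 0 < Fintype.card I := Fintype.card_pos_iff.2 ⟨i₀⟩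
      omega
    · rw [hd₀, Finset.image_image]
      ext j; simp [hc']
  have hL : Odd (∑ d ∈ doors, (rooms.bipartiteAbove (fun d s => d ⊆ s) d).card) := by
    rw [← Finset.add_sum_erase _ _ hd0m]
    apply Odd.add_even
    · obtain ⟨x, -, hx⟩ := Finset.exists_max_image (univ : Finset T) (k i₀) univ_nonempty
      have : rooms.bipartiteAbove (fun d s => d ⊆ s) d₀ = {insert (Sum.inl x) d₀} := by
        ext s
        rw [hroomsAbove _ hd0m, mem_singleton]
        constructor
        · rintro ⟨z, hz, hdom, rfl⟩
          rcases z with x' | j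
          · obtain ⟨i, hi, h⟩ := hdom x
            have : i = i₀ := by
              by_contra hne
              exact hi (by simp [hd0r, hne])
            subst this
            have := hk i (le_antisymm (hx x' (mem_univ _)) (h x' (by simp)))
            rw [this]
          · exfalso
            have hj : j = i₀ := by
              by_contra hne
              exact hz ((hd0r j).2 hne)
            subst hj
            obtain ⟨i, hi, _⟩ := hdom x
            apply hi
            by_cases h : i = j
            · simp [h]
            · simp [hd0r, h]
        · rintro rfl
          refine ⟨_, hd0l x, ?_, rfl⟩
          intro y
          refine ⟨i₀, by simp [hd0r], ?_⟩
          intro x' hx'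
          have : x' = x := by simpa [hd0l] using hx'
          rw [this]; exact hx y (mem_univ _)
      rw [this]; simp
    · apply Finset.even_sum
      intro d hd
      obtain ⟨hdne, hd⟩ := Finset.mem_erase.1 hd
      have hd' := hd
      simp only [hdoors, mem_filter, mem_univ, true_and] at hd'
      obtain ⟨h1, h2, h3⟩ := hd'
      have hne : d.toLeft.Nonempty := by
        rw [Finset.nonempty_iff_ne_empty]
        intro hem
        have hl : ∀ x, Sum.inl x ∉ d := by
          intro x hx
          have : x ∈ d.toLeft := by simpa using hx
          simp [hem] at this
        apply hdne
        apply Finset.eq_of_subset_of_card_le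
        · intro z hz
          rcases z with x | j
          · exact absurd hz (hl x)
          · rw [hd0r]
            have : c' (Sum.inr j) ∈ d.image c' := Finset.mem_image_of_mem _ hz
            rw [h3] at this
            simpa [hc'] using this
        · have := hd0m
          simp only [hdoors, mem_filter, mem_univ, true_and] at this
          omega
      obtain ⟨z₁, z₂, hz12, hz⟩ := door_two k hk d h1 h2 hne
      have : rooms.bipartiteAbove (fun d s => d ⊆ s) d = {insert z₁ d, insert z₂ d} := by
        ext s
        rw [hroomsAbove _ hd, mem_insert, mem_singleton]
        constructor
        · rintro ⟨z, hzd, hdom, rfl⟩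
          rcases (hz z).1 ⟨hzd, hdom⟩ with rfl | rfl
          · exact Or.inl rfl
          · exact Or.inr rfl
        · rintro (rfl | rfl)
          · obtain ⟨ha, hb⟩ := (hz z₁).2 (Or.inl rfl)
            exact ⟨z₁, ha, hb, rfl⟩
          · obtain ⟨ha, hb⟩ := (hz z₂).2 (Or.inr rfl)
            exact ⟨z₂, ha, hb, rfl⟩
      rw [this, Finset.card_pair]
      · exact even_two
      · intro h
        have hm : z₁ ∈ insert z₂ d := by rw [← h]; simp
        rcases Finset.mem_insert.1 hm with h' | h'
        · exact hz12 h'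
        · exact ((hz z₁).2 (Or.inl rfl)).1 h'
  rw [key] at hL
  exact (Nat.not_odd_iff_even.2 hR) hL

/-- grid version -/
theorem scarf' [Nonempty T] [Nonempty I] (k : I → T → R) (hk : ∀ i, Function.Injective (k i))
    (c : T → I) : ∃ (σ : Finset T) (C : Finset I), C.Nonempty ∧
      (∀ y, ∃ i ∈ C, ∀ x ∈ σ, k i y ≤ k i x) ∧ ∀ i ∈ C, ∃ x ∈ σ, c x = i := by
  classical
  obtain ⟨S, hS, hc⟩ := scarf k hk c
  refine ⟨S.toLeft, univ.filter fun i => Sum.inr i ∉ S, ?_, ?_, ?_⟩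
  · obtain ⟨y⟩ := ‹Nonempty T›
    obtain ⟨i, hi, _⟩ := hS y
    exact ⟨i, by simpa using hi⟩
  · intro y
    obtain ⟨i, hi, h⟩ := hS y
    exact ⟨i, by simpa using hi, fun x hx => h x (by simpa using hx)⟩
  · intro i hi
    have hi : Sum.inr i ∉ S := by simpa using hi
    have : i ∈ S.image (Sum.elim c id) := by rw [hc]; simp
    obtain ⟨z, hz, h⟩ := Finset.mem_image.1 this
    rcases z with x | j
    · exact ⟨x, by simpa using hz, by simpa using h⟩
    · simp only [Sum.elim_inr, id] at h
      subst h; exact absurd hz hi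
end ScarfB
namespace ScarfB
open Finset Filter Topology

theorem grid_step {I : Type} [Fintype I] [DecidableEq I] [Nonempty I] (N : ℕ) 
    (c : (I → ℕ) → I) : ∃ (σ : Finset (I → ℕ)) (C : Finset I), C.Nonempty ∧
      (∀ x ∈ σ, ∑ i, x i = N) ∧ (∀ i ∈ C, ∃ x ∈ σ, c x = i) ∧
      (∀ x ∈ σ, ∀ x' ∈ σ, ∀ j, x j ≤ x' j + Fintype.card I) ∧
      (∀ x ∈ σ, ∀ j, j ∉ C → x j ≤ Fintype.card I) := by
  classical
  let T := {x : I → Fin (N+1) // ∑ i, (x i : ℕ) = N}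
  have mk : ∀ y : I → ℕ, ∑ i, y i = N → ∃ t : T, ∀ i, (t.1 i : ℕ) = y i := by
    intro y hy
    have hle : ∀ i, y i < N + 1 := by
      intro i
      have := Finset.single_le_sum (f := y) (fun j _ => Nat.zero_le _) (mem_univ i)
      omega
    exact ⟨⟨fun i => ⟨y i, hle i⟩, by simpa using hy⟩, fun i => rfl⟩
  have : Nonempty T := by
    obtain ⟨i₀⟩ := ‹Nonempty I›
    obtain ⟨t, _⟩ := mk (fun i => if i = i₀ then N else 0) (by simp)
    exact ⟨t⟩
  let k : I → T → ℕ ×ₗ Fin (Fintype.card T) := fun i x => toLex ((x.1 i : ℕ), Fintype.equivFin T x)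
  have hk : ∀ i, Function.Injective (k i) := by
    intro i x y h
    have := congrArg (fun z => (ofLex z).2) h
    exact (Fintype.equivFin T).injective this
  have hkle : ∀ i x y, k i x ≤ k i y → (x.1 i : ℕ) ≤ y.1 i := by
    intro i x y h
    rcases Prod.Lex.le_iff.1 h with h | h
    · exact h.le
    · exact h.1.le
  obtain ⟨σ, C, hC, hdom, hcol⟩ := scarf' k hk (fun x : T => c (fun i => x.1 i))
  have hσ : σ.Nonempty := by
    obtain ⟨i, hi⟩ := hC
    obtain ⟨x, hx, _⟩ := hcol i hi
    exact ⟨x, hx⟩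
  have hmin : ∀ i, ∃ x ∈ σ, ∀ y ∈ σ, (x.1 i : ℕ) ≤ y.1 i := fun i =>
    Finset.exists_min_image σ (fun x => (x.1 i : ℕ)) hσ
  choose w hw hwm using hmin
  set m : I → ℕ := fun i => (w i).1 i with hm
  have hsum : N < ∑ i ∈ C, (m i + 1) := by
    by_contra hcon
    push Not at hcon
    obtain ⟨i₁, hi₁⟩ := hC
    obtain ⟨t, ht⟩ := mk (fun i => (if i ∈ C then m i + 1 else 0) +
      if i = i₁ then N - ∑ i ∈ C, (m i + 1) else 0) (by
        rw [Finset.sum_add_distrib, Finset.sum_ite_mem]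
        rw [Finset.sum_ite_eq' univ i₁]; simp only [mem_univ, if_true, Finset.univ_inter]; omega)
    obtain ⟨i, hi, h⟩ := hdom t
    have h1 := hkle _ _ _ (h (w i) (hw i))
    rw [ht i, if_pos hi] at h1
    simp only [hm] at h1
    omega
  have hCn : C.card ≤ Fintype.card I := Finset.card_le_univ _
  rw [Finset.sum_add_distrib] at hsum
  simp only [sum_const, smul_eq_mul, mul_one] at hsum
  have hsplit : ∀ x : T, ∑ i ∈ C, (x.1 i : ℕ) + ∑ i ∈ Cᶜ, (x.1 i : ℕ) = N := by
    intro x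
    rw [Finset.sum_add_sum_compl]; exact x.2
  have hin : ∀ x ∈ σ, ∀ j ∈ C, (x.1 j : ℕ) ≤ m j + Fintype.card I := by
    intro x hx j hj
    have h1 := hsplit x
    have h2 : ∑ i ∈ C.erase j, m i ≤ ∑ i ∈ C.erase j, (x.1 i : ℕ) :=
      Finset.sum_le_sum fun i _ => hwm i x hx
    rw [← Finset.add_sum_erase _ _ hj] at h1 hsum
    omega
  have hout : ∀ x ∈ σ, ∀ j, j ∉ C → (x.1 j : ℕ) ≤ Fintype.card I := by
    intro x hx j hj
    have h1 := hsplit x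
    have h2 : ∑ i ∈ C, m i ≤ ∑ i ∈ C, (x.1 i : ℕ) :=
      Finset.sum_le_sum fun i _ => hwm i x hx
    have h3 := Finset.single_le_sum (s := Cᶜ) (f := fun i => (x.1 i : ℕ))
      (fun j _ => Nat.zero_le _) (by simpa using hj : j ∈ Cᶜ)
    omega
  refine ⟨σ.image (fun x i => (x.1 i : ℕ)), C, hC, ?_, ?_, ?_, ?_⟩
  · intro x hx
    obtain ⟨x, hxσ, rfl⟩ := Finset.mem_image.1 hx
    exact x.2
  · intro i hi
    obtain ⟨x, hx, h⟩ := hcol i hi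
    exact ⟨_, Finset.mem_image_of_mem _ hx, h⟩
  · intro x hx x' hx' j
    obtain ⟨x, hxσ, rfl⟩ := Finset.mem_image.1 hx
    obtain ⟨x', hxσ', rfl⟩ := Finset.mem_image.1 hx'
    by_cases hj : j ∈ C
    · have h1 := hin x hxσ j hj
      have h2 : m j ≤ x'.1 j := hwm j x' hxσ'
      simp only; omega
    · have h1 := hout x hxσ j hj
      simp only; omega
  · intro x hx j hj
    obtain ⟨x, hxσ, rfl⟩ := Finset.mem_image.1 hx
    exact hout x hxσ j hj

theorem real_step {I : Type} [Fintype I] [Nonempty I] (f : (I → ℝ) → (I → ℝ))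
    (hf : ∀ t ∈ stdSimplex ℝ I, f t ∈ stdSimplex ℝ I) (N : ℕ) :
    ∃ (C : Finset I) (q : I → ℝ) (p : I → I → ℝ), q ∈ stdSimplex ℝ I ∧
      (∀ i ∈ C, p i ∈ stdSimplex ℝ I ∧ p i i ≤ f (p i) i) ∧
      (∀ i ∈ C, ∀ j, |p i j - q j| ≤ Fintype.card I / ((N : ℝ) + 1)) ∧
      (∀ j, j ∉ C → q j ≤ Fintype.card I / ((N : ℝ) + 1)) := by
  classical
  let pt : (I → ℕ) → I → ℝ := fun x i => (x i : ℝ) / ((N : ℝ) + 1)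
  have hN : (0 : ℝ) < (N : ℝ) + 1 := by positivity
  have hpt : ∀ x : I → ℕ, ∑ i, x i = N + 1 → pt x ∈ stdSimplex ℝ I := by
    intro x hx
    refine ⟨fun i => by simp only [pt]; positivity, ?_⟩
    simp only [pt]
    rw [← Finset.sum_div, div_eq_one_iff_eq hN.ne']
    exact_mod_cast hx
  have hcol : ∀ x : I → ℕ, ∃ i, ∑ i, x i = N + 1 → pt x i ≤ f (pt x) i := by
    intro x
    by_cases hx : ∑ i, x i = N + 1
    · have h1 := hpt x hx
      have h2 := hf _ h1
      obtain ⟨i, _, hi⟩ := Finset.exists_le_of_sum_le (s := univ) (f := pt x) (g := f (pt x))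
        univ_nonempty (by rw [h1.2, h2.2])
      exact ⟨i, fun _ => hi⟩
    · exact ⟨Classical.arbitrary I, fun h => absurd h hx⟩
  choose c hc using hcol
  obtain ⟨σ, C, ⟨i₀, hi₀⟩, hsum, hcolor, hclose, hout⟩ := grid_step (N + 1) c
  obtain ⟨x₀, hx₀, _⟩ := hcolor i₀ hi₀
  have : ∀ i, ∃ x, i ∈ C → x ∈ σ ∧ c x = i := by
    intro i
    by_cases h : i ∈ C
    · obtain ⟨x, hx⟩ := hcolor i h
      exact ⟨x, fun _ => hx⟩
    · exact ⟨x₀, fun h' => absurd h' h⟩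
  choose x hx using this
  refine ⟨C, pt x₀, fun i => pt (x i), hpt _ (hsum _ hx₀), ?_, ?_, ?_⟩
  · intro i hi
    obtain ⟨h1, h2⟩ := hx i hi
    refine ⟨hpt _ (hsum _ h1), ?_⟩
    have := hc (x i) (hsum _ h1)
    rwa [h2] at this
  · intro i hi j
    obtain ⟨h1, h2⟩ := hx i hi
    simp only [pt]
    rw [← sub_div, abs_div, abs_of_pos hN]
    apply div_le_div_of_nonneg_right _ hN.le
    have ha : (x i j : ℝ) ≤ x₀ j + Fintype.card I := by exact_mod_cast hclose _ h1 _ hx₀ j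
    have hb : (x₀ j : ℝ) ≤ x i j + Fintype.card I := by exact_mod_cast hclose _ hx₀ _ h1 j
    rw [abs_le]; constructor <;> linarith
  · intro j hj
    simp only [pt]
    apply div_le_div_of_nonneg_right _ hN.le
    exact_mod_cast hout _ hx₀ j hj

theorem brouwer {I : Type} [Fintype I] [Nonempty I] (f : (I → ℝ) → (I → ℝ))
    (hf : ∀ t ∈ stdSimplex ℝ I, f t ∈ stdSimplex ℝ I) (hc : ContinuousOn f (stdSimplex ℝ I)) :
    ∃ t ∈ stdSimplex ℝ I, f t = t := by
  classical
  choose C q p hq hp hclose hout using real_step f hf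
  let U : Ultrafilter ℕ := Filter.hyperfilter ℕ
  have hU : (U : Filter ℕ) ≤ atTop := by
    rw [← Nat.cofinite_eq_atTop]; exact Filter.hyperfilter_le_cofinite
  obtain ⟨t, ht, hlim⟩ := (isCompact_stdSimplex ℝ I).ultrafilter_le_nhds' (U.map q)
    (by rw [Ultrafilter.mem_map]; exact Filter.Eventually.of_forall hq)
  have hlim : Tendsto q U (𝓝 t) := hlim
  have hlimj : ∀ j, Tendsto (fun N => q N j) U (𝓝 (t j)) := fun j =>
    (tendsto_pi_nhds.1 hlim) j
  have hzero : Tendsto (fun N : ℕ => (Fintype.card I : ℝ) / ((N : ℝ) + 1)) U (𝓝 0) :=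
    ((tendsto_const_div_atTop_nhds_zero_nat (Fintype.card I : ℝ)).comp
      (tendsto_add_atTop_nat 1)).mono_left hU |>.congr (fun N => by simp)
  have hle : ∀ j, t j ≤ f t j := by
    intro j
    rcases Ultrafilter.em U (fun N => j ∈ C N) with h | h
    · have hpj : Tendsto (fun N => p N j) U (𝓝 t) := by
        rw [tendsto_pi_nhds]
        intro i
        have h1 : Tendsto (fun N => p N j i - q N i) U (𝓝 0) := by
          apply squeeze_zero_norm' _ hzero
          filter_upwards [h] with N hN
          exact hclose N j hN i
        simpa using h1.add (hlimj i)
      have hpj' : Tendsto (fun N => p N j) U (𝓝[stdSimplex ℝ I] t) := by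
        rw [tendsto_nhdsWithin_iff]
        exact ⟨hpj, by filter_upwards [h] with N hN using (hp N j hN).1⟩
      have h2 := (hc t ht).tendsto.comp hpj'
      have h3 := (tendsto_pi_nhds.1 h2) j
      have h4 := (tendsto_pi_nhds.1 hpj) j
      apply le_of_tendsto_of_tendsto h4 h3
      filter_upwards [h] with N hN using (hp N j hN).2
    · have : t j ≤ 0 := by
        apply le_of_tendsto_of_tendsto (hlimj j) hzero
        filter_upwards [h] with N hN using hout N j hN
      exact this.trans ((hf t ht).1 j)
  refine ⟨t, ht, ?_⟩
  have hs : ∑ j, t j = ∑ j, f t j := by rw [ht.2, (hf t ht).2]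
  funext j
  exact ((Finset.sum_eq_sum_iff_of_le (fun i _ => hle i)).1 hs j (mem_univ j)).symm

/-- finite-dimensional variational statement -/
theorem fin_kkm {I : Type} [Fintype I] [Nonempty I] (g : (I → ℝ) → I → ℝ)
    (hc : ContinuousOn g (stdSimplex ℝ I)) (hg : ∀ t ∈ stdSimplex ℝ I, ∑ i, t i * g t i ≤ 0) :
    ∃ t ∈ stdSimplex ℝ I, ∀ i, g t i ≤ 0 := by
  set s : (I → ℝ) → ℝ := fun t => ∑ i, max (g t i) 0 with hs
  have hs0 : ∀ t, 0 ≤ s t := fun t => Finset.sum_nonneg fun i _ => le_max_right _ _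
  have hgi : ∀ i, ContinuousOn (fun t => g t i) (stdSimplex ℝ I) := fun i =>
    (continuous_apply i).comp_continuousOn hc
  obtain ⟨t, ht, hfix⟩ := brouwer (fun t i => (t i + max (g t i) 0) / (1 + s t))
    (by
      intro t ht
      have := hs0 t
      refine ⟨fun i => div_nonneg (add_nonneg (ht.1 i) (le_max_right _ _)) (by linarith), ?_⟩
      rw [← Finset.sum_div, Finset.sum_add_distrib, ht.2]
      exact div_self (by simp only [hs] at this ⊢; linarith))
    (by
      rw [continuousOn_pi]
      intro i
      apply ContinuousOn.div
      · exact (continuous_apply i).continuousOn.add ((hgi i).sup continuousOn_const)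
      · apply continuousOn_const.add
        exact continuousOn_finsetSum _ fun i _ => (hgi i).sup continuousOn_const
      · intro t _
        have := hs0 t
        linarith)
  have h1 : ∀ i, max (g t i) 0 = t i * s t := by
    intro i
    have h := congrFun hfix i
    have := hs0 t
    rw [div_eq_iff (by linarith)] at h
    linarith
  refine ⟨t, ht, ?_⟩
  by_contra hcon
  push Not at hcon
  obtain ⟨i₀, hi₀⟩ := hcon
  have hspos : 0 < s t := by
    have h2 := h1 i₀
    rw [max_eq_left hi₀.le] at h2
    by_contra hle
    have : s t = 0 := le_antisymm (not_lt.1 hle) (hs0 t)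
    rw [this] at h2; simp at h2; linarith
  have hterm : ∀ i, t i * g t i = t i * (t i * s t) := by
    intro i
    rcases (ht.1 i).eq_or_lt with h0 | hpos
    · rw [← h0]; simp
    · have : 0 < t i * s t := mul_pos hpos hspos
      rw [← h1 i] at this ⊢
      rw [max_eq_left]
      by_contra hneg
      rw [max_eq_right (not_le.1 hneg).le] at this
      exact lt_irrefl _ this
  have hti : 0 < t i₀ := by
    have h2 := h1 i₀
    rw [max_eq_left hi₀.le] at h2
    by_contra hle
    have : t i₀ = 0 := le_antisymm (not_lt.1 hle) (ht.1 i₀)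
    rw [this] at h2; simp at h2; linarith
  have : 0 < ∑ i, t i * g t i := by
    apply Finset.sum_pos'
    · intro i _
      rw [hterm]
      exact mul_nonneg (ht.1 i) (mul_nonneg (ht.1 i) hspos.le)
    · exact ⟨i₀, mem_univ _, mul_pos hti hi₀⟩
  linarith [hg t ht]

/-- An abstract Ky Fan type inequality. -/
theorem ky_fan {K : Type*} [TopologicalSpace K] [CompactSpace K] [Nonempty K] (F : K → K → ℝ)
    (hF : ∀ y, Continuous fun x => F x y)
    (hconv : ∀ (m : ℕ) (y : Fin (m + 1) → K), ∃ e : stdSimplex ℝ (Fin (m + 1)) → K,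
      Continuous e ∧ ∀ t, ∑ j, t.1 j * F (e t) (y j) ≤ 0) :
    ∃ x, ∀ y, F x y ≤ 0 := by
  classical
  have hcl : ∀ y, IsClosed {x | F x y ≤ 0} := fun y => isClosed_le (hF y) continuous_const
  have hne : (⋂ y, {x | F x y ≤ 0}).Nonempty := by
    rw [Set.nonempty_iff_ne_empty]
    intro hem
    obtain ⟨u, hu⟩ := isCompact_univ.elim_finite_subfamily_closed (fun y => {x | F x y ≤ 0}) hcl
      (by rw [hem]; simp)
    rw [Set.univ_inter] at hu
    have : ∃ x, ∀ y ∈ u, F x y ≤ 0 := by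
      rcases u.eq_empty_or_nonempty with rfl | hune
      · exact ⟨Classical.arbitrary K, by simp⟩
      · obtain ⟨m, hm⟩ : ∃ m, u.card = m + 1 := ⟨u.card - 1, by have := hune.card_pos; omega⟩
        let y : Fin (m + 1) → K := fun j => (u.equivFinOfCardEq hm).symm j
        obtain ⟨e₀, he₀, hs₀⟩ := hconv m y
        let e : (Fin (m + 1) → ℝ) → K := fun t =>
          if h : t ∈ stdSimplex ℝ (Fin (m + 1)) then e₀ ⟨t, h⟩ else Classical.arbitrary K
        have hee : ∀ t (h : t ∈ stdSimplex ℝ (Fin (m + 1))), e t = e₀ ⟨t, h⟩ :=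
          fun t h => dif_pos h
        have he : ContinuousOn e (stdSimplex ℝ (Fin (m + 1))) := by
          rw [continuousOn_iff_continuous_domRestrict]
          exact he₀.congr (fun t => (hee t.1 t.2).symm)
        have hs : ∀ t ∈ stdSimplex ℝ (Fin (m + 1)), ∑ j, t j * F (e t) (y j) ≤ 0 := by
          intro t ht
          rw [hee t ht]
          exact hs₀ ⟨t, ht⟩
        obtain ⟨t, _, ht⟩ := fin_kkm (fun t j => F (e t) (y j))
          (by rw [continuousOn_pi]; exact fun j => (hF (y j)).comp_continuousOn he) hs
        refine ⟨e t, fun z hz => ?_⟩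
        have := ht ((u.equivFinOfCardEq hm) ⟨z, hz⟩)
        simpa [y] using this
    obtain ⟨x, hx⟩ := this
    have : x ∈ ⋂ i ∈ u, {x | F x i ≤ 0} := by simpa using hx
    rw [hu] at this
    exact this
  obtain ⟨x, hx⟩ := hne
  exact ⟨x, fun y => by simpa using Set.mem_iInter.1 hx y⟩
end ScarfB

open CSGame

namespace CSGame

variable {n l : ℕ}
variable {X : Type} [Countable X] [MeasurableSpace X] [DiscreteMeasurableSpace X]
  [TopologicalSpace X] [DiscreteTopology X] [BorelSpace X] [SecondCountableTopology X]
variable {A : Fin n → Type} [∀ i, MeasurableSpace (A i)] [∀ i, TopologicalSpace (A i)]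
  [∀ i, PolishSpace (A i)] [∀ i, BorelSpace (A i)]
variable (G : GameData n l X A)

/-! ### Measurability -/

theorem integrable_bdd {Ω : Type*} [MeasurableSpace Ω] (μ : Measure Ω) [IsProbabilityMeasure μ]
    {f : Ω → ℝ} (hf : Measurable f) {C : ℝ} (hC : ∀ x, |f x| ≤ C) : Integrable f μ :=
  Integrable.of_bound hf.aestronglyMeasurable C (ae_of_all _ hC)

theorem abs_integral_bdd {Ω : Type*} [MeasurableSpace Ω] (μ : Measure Ω) [IsProbabilityMeasure μ]
    {f : Ω → ℝ} {C : ℝ} (hC : ∀ x, |f x| ≤ C) : |∫ x, f x ∂μ| ≤ C := by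
  have := norm_integral_le_of_norm_le_const (μ := μ) (f := f) (C := C) (ae_of_all _ hC)
  simpa using this

theorem integral_bind_bdd {α β : Type*} [MeasurableSpace α] [MeasurableSpace β]
    (μ : Measure α) [IsProbabilityMeasure μ] {κ : α → Measure β} (hκ : Measurable κ)
    (hp : ∀ a, IsProbabilityMeasure (κ a)) {f : β → ℝ} (hf : Measurable f) {C : ℝ}
    (hC : ∀ x, |f x| ≤ C) : ∫ b, f b ∂(μ.bind κ) = ∫ a, ∫ b, f b ∂(κ a) ∂μ := by
  let k : Kernel α β := ⟨κ, hκ⟩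
  have : IsMarkovKernel k := ⟨hp⟩
  have h : (μ.bind κ) = (k ∘ₖ (Kernel.const Unit μ)) () := by
    rw [Kernel.comp_apply]; rfl
  rw [h, Kernel.integral_comp]
  · rfl
  · exact integrable_bdd _ hf hC

theorem isProb_bind {α β : Type*} [MeasurableSpace α] [MeasurableSpace β]
    (μ : Measure α) [IsProbabilityMeasure μ] {κ : α → Measure β} (hκ : Measurable κ)
    (hp : ∀ a, IsProbabilityMeasure (κ a)) : IsProbabilityMeasure (μ.bind κ) := by
  constructor
  rw [Measure.bind_apply MeasurableSet.univ hκ.aemeasurable]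
  simp

theorem measurable_p (x : X) : Measurable (G.p x) := by
  refine Measure.measurable_of_measurable_coe _ fun s _ => ?_
  have : ∀ a, G.p x a s = ∑' y : s, G.p x a {y.1} := fun a => by
    rw [← Measure.tsum_indicator_apply_singleton _ s (MeasurableSet.of_discrete)]
    rw [tsum_subtype s (fun y => G.p x a {y})]
  simp_rw [this]
  exact Measurable.tsum fun y => G.hpm x y.1

theorem measurable_p2 : Measurable (fun q : X × JA A => G.p q.1 q.2) :=
  measurable_from_prod_countable_right fun x => measurable_p G x

instance isProb_p (x : X) (a : JA A) : IsProbabilityMeasure (G.p x a) := G.hp x a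

instance isProb_jointLaw (π : MultiStrategy G) (t : ℕ) (h : Hist X (JA A) t) :
    IsProbabilityMeasure (jointLaw G π t h) := by
  unfold jointLaw; infer_instance

theorem measurable_jointLaw (π : MultiStrategy G) (t : ℕ) : Measurable (jointLaw G π t) := by
  refine Measurable.measure_of_isPiSystem_of_isProbabilityMeasure generateFrom_pi.symm
    isPiSystem_pi ?_
  rintro s ⟨u, hu, rfl⟩
  simp only [jointLaw, Measure.pi_pi]
  exact Finset.measurable_fun_prod _ fun i _ => (π i).meas t (u i) (hu i (Set.mem_univ i))

/-- Next state law. -/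
noncomputable def nxt (x : X) (ν : Measure (JA A)) : Measure X := ν.bind (G.p x)

instance isProb_nxt (x : X) (ν : Measure (JA A)) [IsProbabilityMeasure ν] :
    IsProbabilityMeasure (nxt G x ν) := isProb_bind ν (measurable_p G x) (G.hp x)

theorem measurable_step (t : ℕ) :
    Measurable (fun q : Hist X (JA A) t × JA A => 
      (G.p (lastState X (JA A) t q.1) q.2).map fun y =>
            (show Hist X (JA A) (t + 1) from (q.1, q.2, y))) := by
  refine Measure.measurable_of_measurable_coe _ fun s hs => ?_
  have hm : ∀ q : Hist X (JA A) t × JA A, Measurable (fun y : X => 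
    (show Hist X (JA A) (t + 1) from (q.1, q.2, y))) := fun q =>
      measurable_const.prodMk (measurable_const.prodMk measurable_id)
  simp_rw [Measure.map_apply (hm _) hs]
  let k : Kernel (Hist X (JA A) t × JA A) X :=
    ⟨fun q => G.p (lastState X (JA A) t q.1) q.2, (measurable_p2 G).comp
      (((measurable_lastState X (JA A) t).comp measurable_fst).prodMk measurable_snd)⟩
  have : IsMarkovKernel k := ⟨fun q => G.hp _ _⟩
  have hs' : MeasurableSet {z : (Hist X (JA A) t × JA A) × X |
      (show Hist X (JA A) (t + 1) from (z.1.1, z.1.2, z.2)) ∈ s} := by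
    refine measurableSet_preimage (f := fun z : (Hist X (JA A) t × JA A) × X => 
      (show Hist X (JA A) (t + 1) from (z.1.1, z.1.2, z.2))) ?_ hs
    exact (measurable_fst.comp measurable_fst).prodMk
      ((measurable_snd.comp measurable_fst).prodMk measurable_snd)
  exact Kernel.measurable_kernel_prodMk_left (κ := k) hs'

noncomputable def stepK (π : MultiStrategy G) (t : ℕ) (h : Hist X (JA A) t) :
    Measure (Hist X (JA A) (t + 1)) :=
  (jointLaw G π t h).bind fun a =>
          (G.p (lastState X (JA A) t h) a).map fun y =>
            (show Hist X (JA A) (t + 1) from (h, a, y))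

theorem measurable_step1 (t : ℕ) (h : Hist X (JA A) t) :
    Measurable (fun a : JA A => 
      (G.p (lastState X (JA A) t h) a).map fun y =>
            (show Hist X (JA A) (t + 1) from (h, a, y))) :=
  (measurable_step G t).comp (measurable_const.prodMk measurable_id)

instance isProb_stepK (π : MultiStrategy G) (t : ℕ) (h : Hist X (JA A) t) :
    IsProbabilityMeasure (stepK G π t h) := by
  refine isProb_bind _ (measurable_step1 G t h) fun a => ?_
  refine Measure.isProbabilityMeasure_map ?_
  exact (measurable_const.prodMk (measurable_const.prodMk measurable_id)).aemeasurable

theorem measurable_stepK (π : MultiStrategy G) (t : ℕ) : Measurable (stepK G π t) := by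
  refine Measure.measurable_of_measurable_coe _ fun s hs => ?_
  have : ∀ h, stepK G π t h s = ∫⁻ a, ((G.p (lastState X (JA A) t h) a).map fun y =>
            (show Hist X (JA A) (t + 1) from (h, a, y))) s ∂(jointLaw G π t h) := fun h =>
    Measure.bind_apply hs (measurable_step1 G t h).aemeasurable
  simp_rw [this]
  let k : Kernel (Hist X (JA A) t) (JA A) := ⟨jointLaw G π t, measurable_jointLaw G π t⟩
  have : IsMarkovKernel k := ⟨fun q => isProb_jointLaw G π t q⟩
  exact Measurable.lintegral_kernel_prod_right' (κ := k)
    (((Measure.measurable_coe hs).comp (measurable_step G t)))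

instance isProb_histMeas (π : MultiStrategy G) (t : ℕ) :
    IsProbabilityMeasure (histMeas G G.η π t) := by
  induction t with
  | zero => exact G.hη
  | succ t ih =>
    exact isProb_bind _ (measurable_stepK G π t) (isProb_stepK G π t)

theorem measurable_int_law (π : MultiStrategy G) (t : ℕ) {f : X → JA A → ℝ}
    (hf : ∀ x, Measurable (f x)) :
    Measurable fun h => ∫ a, f (lastState X (JA A) t h) a ∂(jointLaw G π t h) := by
  let k : Kernel (Hist X (JA A) t) (JA A) := ⟨jointLaw G π t, measurable_jointLaw G π t⟩
  have : IsMarkovKernel k := ⟨fun q => isProb_jointLaw G π t q⟩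
  have hf2 : Measurable (fun q : X × JA A => f q.1 q.2) :=
    measurable_from_prod_countable_right fun x => hf x
  have : StronglyMeasurable (fun q : Hist X (JA A) t × JA A => 
      f (lastState X (JA A) t q.1) q.2) :=
    (hf2.comp (((measurable_lastState X (JA A) t).comp measurable_fst).prodMk
      measurable_snd)).stronglyMeasurable
  exact (StronglyMeasurable.integral_kernel_prod_right' (κ := k) this).measurable

theorem measurable_int_p (W : X → ℝ) (x : X) :
    Measurable fun a => ∫ y, W y ∂(G.p x a) := by
  let k : Kernel (JA A) X := ⟨G.p x, measurable_p G x⟩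
  exact (StronglyMeasurable.integral_kernel (κ := k) 
    (Measurable.of_discrete (f := W)).stronglyMeasurable).measurable

theorem int_nxt (W : X → ℝ) {C : ℝ} (hW : ∀ x, |W x| ≤ C) (x : X) (ν : Measure (JA A))
    [IsProbabilityMeasure ν] :
    ∫ y, W y ∂(nxt G x ν) = ∫ a, ∫ y, W y ∂(G.p x a) ∂ν :=
  integral_bind_bdd ν (measurable_p G x) (G.hp x) Measurable.of_discrete hW

theorem int_hist_succ (π : MultiStrategy G) (t : ℕ) (W : X → ℝ) {C : ℝ} (hW : ∀ x, |W x| ≤ C) :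
    ∫ h, W (lastState X (JA A) (t + 1) h) ∂(histMeas G G.η π (t + 1)) =
    ∫ h, ∫ y, W y ∂(nxt G (lastState X (JA A) t h) (jointLaw G π t h)) ∂(histMeas G G.η π t) := by
  have hm : Measurable (fun h => W (lastState X (JA A) (t + 1) h)) :=
    (Measurable.of_discrete (f := W)).comp (measurable_lastState X (JA A) (t + 1))
  have h1 : ∫ h, W (lastState X (JA A) (t + 1) h) ∂(histMeas G G.η π (t + 1)) =
    ∫ h, ∫ h', W (lastState X (JA A) (t + 1) h') ∂(stepK G π t h) ∂(histMeas G G.η π t) :=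
    integral_bind_bdd _ (measurable_stepK G π t) (isProb_stepK G π t) hm (fun _ => hW _)
  rw [h1]
  congr 1
  ext h
  rw [int_nxt G W hW]
  have hy : ∀ a, Measurable (fun y : X => (show Hist X (JA A) (t + 1) from (h, a, y))) := fun a =>
    measurable_const.prodMk (measurable_const.prodMk measurable_id)
  rw [stepK, integral_bind_bdd _ (measurable_step1 G t h) (fun a => 
    Measure.isProbabilityMeasure_map (hy a).aemeasurable) hm (fun _ => hW _)]
  congr 1
  ext a
  rw [integral_map (hy a).aemeasurable hm.aestronglyMeasurable]
  rfl

/-! ### Telescoping -/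

/-- One-step operator. -/
noncomputable def Qv (f : X → JA A → ℝ) (W : X → ℝ) (x : X) (ν : Measure (JA A)) : ℝ :=
  ∫ a, f x a ∂ν + G.α * ∫ y, W y ∂(nxt G x ν)

theorem summable_disc {u : ℕ → ℝ} {C : ℝ} (hu : ∀ t, |u t| ≤ C) :
    Summable fun t => G.α ^ t * u t := by
  refine Summable.of_norm_bounded (g := fun t => G.α ^ t * C) 
    ((summable_geometric_of_lt_one G.hα0.le G.hα1).mul_right C) fun t => ?_
  rw [norm_mul, norm_pow, Real.norm_of_nonneg G.hα0.le]
  exact mul_le_mul_of_nonneg_left (hu t) (pow_nonneg G.hα0.le t)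

theorem abs_Qv {f : X → JA A → ℝ} {W : X → ℝ} {C C' : ℝ} (hf : ∀ x a, |f x a| ≤ C)
    (hW : ∀ x, |W x| ≤ C') (x : X) (ν : Measure (JA A)) [IsProbabilityMeasure ν] :
    |Qv G f W x ν| ≤ C + G.α * C' := by
  unfold Qv
  refine (abs_add_le _ _).trans (add_le_add (abs_integral_bdd _ (hf x)) ?_)
  rw [abs_mul, abs_of_pos G.hα0]
  exact mul_le_mul_of_nonneg_left (abs_integral_bdd _ hW) G.hα0.le

theorem measurable_Qv (π : MultiStrategy G) (t : ℕ) {f : X → JA A → ℝ} {W : X → ℝ}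
    {C' : ℝ} (hf : ∀ x, Measurable (f x)) (hW : ∀ x, |W x| ≤ C') :
    Measurable fun h => Qv G f W (lastState X (JA A) t h) (jointLaw G π t h) := by
  unfold Qv
  simp_rw [int_nxt G W hW]
  exact (measurable_int_law G π t hf).add
    ((measurable_int_law G π t (fun x => measurable_int_p G W x)).const_mul _)

/-- Expected one-step gap. -/
noncomputable def gap (π : MultiStrategy G) (t : ℕ) (f : X → JA A → ℝ) (W : X → ℝ) : ℝ :=
  ∫ h, (Qv G f W (lastState X (JA A) t h) (jointLaw G π t h) - W (lastState X (JA A) t h))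
    ∂(histMeas G G.η π t)

theorem abs_gap (π : MultiStrategy G) (t : ℕ) {f : X → JA A → ℝ} {W : X → ℝ} {C C' : ℝ} 
    (hf : ∀ x a, |f x a| ≤ C) (hW : ∀ x, |W x| ≤ C') :
    |gap G π t f W| ≤ C + G.α * C' + C' := by
  refine abs_integral_bdd _ fun h => ?_
  exact (abs_sub _ _).trans (add_le_add (abs_Qv G hf hW _ _) (hW _))

theorem Jfun_tele (π : MultiStrategy G) {f : X → JA A → ℝ} {W : X → ℝ} {C C' : ℝ} 
    (hfm : ∀ x, Measurable (f x))
    (hf : ∀ x a, |f x a| ≤ C) (hW : ∀ x, |W x| ≤ C') :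
    Jfun G G.η f π = (1 - G.α) * (∫ x, W x ∂G.η + ∑' t, G.α ^ t * gap G π t f W) := by
  set s : ℕ → ℝ := fun t => stageExp G G.η π t f with hs
  set w : ℕ → ℝ := fun t => ∫ h, W (lastState X (JA A) t h) ∂(histMeas G G.η π t) with hw
  have hsb : ∀ t, |s t| ≤ C := fun t => abs_integral_bdd _ fun h => abs_integral_bdd _ (hf _)
  have hwb : ∀ t, |w t| ≤ C' := fun t => abs_integral_bdd _ fun h => hW _
  have hg : ∀ t, gap G π t f W = s t + G.α * w (t + 1) - w t := by
    intro t
    have hm1 := measurable_Qv G π t hfm hW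
    have hm2 : Measurable fun h => W (lastState X (JA A) t h) :=
      (Measurable.of_discrete (f := W)).comp (measurable_lastState X (JA A) t)
    unfold gap
    rw [integral_sub (integrable_bdd _ hm1 fun h => abs_Qv G hf hW _ _)
      (integrable_bdd _ hm2 fun h => hW _)]
    congr 1
    have e2 : w (t + 1) = _ := int_hist_succ G π t W hW
    rw [e2]
    unfold Qv
    rw [integral_add, integral_const_mul]
    · rfl
    · exact integrable_bdd _ (measurable_int_law G π t hfm) fun h => abs_integral_bdd _ (hf _)
    · refine Integrable.const_mul (integrable_bdd _ (C := C') ?_ fun h => abs_integral_bdd _ hW) _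
      simp_rw [int_nxt G W hW]
      exact measurable_int_law G π t (fun x => measurable_int_p G W x)
  have h1 := summable_disc G hsb
  have h2 := summable_disc G hwb
  have h3 : Summable fun t => G.α ^ (t + 1) * w (t + 1) := (summable_nat_add_iff 1).2 h2
  have h4 := h2.tsum_eq_zero_add
  have e0 : w 0 = ∫ x, W x ∂G.η := rfl
  have e : ∑' t, G.α ^ t * gap G π t f W = 
      ∑' t, G.α ^ t * s t + ∑' t, G.α ^ (t + 1) * w (t + 1) - ∑' t, G.α ^ t * w t := by
    rw [← h1.tsum_add h3, ← (h1.add h3).tsum_sub h2]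
    refine tsum_congr fun t => ?_
    rw [hg]; ring
  unfold Jfun
  rw [e, h4, ← e0]
  congr 1
  ring

/-! ### Stationary values -/

/-- Joint law of a stationary profile at a state. -/
noncomputable def lawS (φ : StatProfile G) (x : X) : Measure (JA A) :=
  Measure.pi fun j => ((φ j).1 x : Measure (A j))

/-- Joint law when player `i` deviates to `ν`. -/
noncomputable def lawU (φ : StatProfile G) (i : Fin n) (x : X) (ν : ProbabilityMeasure (A i)) :
    Measure (JA A) :=
  Measure.pi fun j => ((Function.update (fun j => (φ j).1 x) i ν j : ProbabilityMeasure (A j)) :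
    Measure (A j))

instance isProb_lawS (φ : StatProfile G) (x : X) : IsProbabilityMeasure (lawS G φ x) := by
  unfold lawS; infer_instance

instance isProb_lawU (φ : StatProfile G) (i : Fin n) (x : X) (ν : ProbabilityMeasure (A i)) :
    IsProbabilityMeasure (lawU G φ i x ν) := by
  unfold lawU; infer_instance

theorem lawU_self (φ : StatProfile G) (i : Fin n) (x : X) :
    lawU G φ i x ((φ i).1 x) = lawS G φ x := by
  unfold lawU lawS
  rw [Function.update_eq_self]

/-- Stage values. -/
noncomputable def Rv (f : X → JA A → ℝ) (φ : StatProfile G) : ℕ → X → ℝ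
  | 0 => fun x => ∫ a, f x a ∂(lawS G φ x)
  | t + 1 => fun x => ∫ y, Rv f φ t y ∂(nxt G x (lawS G φ x))

/-- Discounted value of a stationary profile. -/
noncomputable def Wv (f : X → JA A → ℝ) (φ : StatProfile G) (x : X) : ℝ :=
  ∑' t, G.α ^ t * Rv G f φ t x

theorem abs_Rv {f : X → JA A → ℝ} {C : ℝ} (hf : ∀ x a, |f x a| ≤ C) (φ : StatProfile G)
    (t : ℕ) (x : X) : |Rv G f φ t x| ≤ C := by
  induction t generalizing x with
  | zero => exact abs_integral_bdd _ (hf x)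
  | succ t ih => exact abs_integral_bdd _ ih

theorem abs_Wv {f : X → JA A → ℝ} {C : ℝ} (hf : ∀ x a, |f x a| ≤ C) (φ : StatProfile G)
    (x : X) : |Wv G f φ x| ≤ (1 - G.α)⁻¹ * C := by
  have h := (hasSum_geometric_of_lt_one G.hα0.le G.hα1).mul_right C
  rw [← Real.norm_eq_abs]
  refine tsum_of_norm_bounded (f := fun t => G.α ^ t * Rv G f φ t x) h fun t => ?_
  rw [norm_mul, norm_pow, Real.norm_of_nonneg G.hα0.le]
  exact mul_le_mul_of_nonneg_left (abs_Rv G hf φ t x) (pow_nonneg G.hα0.le t)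

theorem bellman {f : X → JA A → ℝ} {C : ℝ} (hf : ∀ x a, |f x a| ≤ C) (φ : StatProfile G)
    (x : X) : Wv G f φ x = Qv G f (Wv G f φ) x (lawS G φ x) := by
  have hC : 0 ≤ C := (abs_nonneg _).trans (abs_Rv G hf φ 0 x)
  have hs : ∀ y, Summable fun t => G.α ^ t * Rv G f φ t y := fun y =>
    summable_disc G (fun t => abs_Rv G hf φ t y)
  have h1 := (hs x).tsum_eq_zero_add
  have h2 : HasSum (fun t => ∫ y, G.α ^ t * Rv G f φ t y ∂(nxt G x (lawS G φ x)))
      (∫ y, ∑' t, G.α ^ t * Rv G f φ t y ∂(nxt G x (lawS G φ x))) := by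
    refine hasSum_integral_of_summable_integral_norm (fun t => ?_) ?_
    · exact (integrable_bdd _ Measurable.of_discrete (abs_Rv G hf φ t)).const_mul _
    · refine Summable.of_nonneg_of_le (fun t => integral_nonneg fun y => norm_nonneg _) (fun t => ?_)
        ((summable_geometric_of_lt_one G.hα0.le G.hα1).mul_right C)
      refine (le_abs_self _).trans (abs_integral_bdd _ fun y => ?_)
      rw [abs_norm, norm_mul, norm_pow, Real.norm_of_nonneg G.hα0.le]
      exact mul_le_mul_of_nonneg_left (abs_Rv G hf φ t y) (pow_nonneg G.hα0.le t)
  unfold Qv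
  change _ = Rv G f φ 0 x + G.α * ∫ y, ∑' t, G.α ^ t * Rv G f φ t y ∂(nxt G x (lawS G φ x))
  rw [← h2.tsum_eq, ← tsum_mul_left]
  change ∑' t, G.α ^ t * Rv G f φ t x = _
  rw [h1]
  congr 1
  · simp
  · refine tsum_congr fun t => ?_
    rw [integral_const_mul, pow_succ']
    change _ * _ * ∫ y, Rv G f φ t y ∂(nxt G x (lawS G φ x)) = _
    ring

theorem J_stat {f : X → JA A → ℝ} {C : ℝ} (hfm : ∀ x, Measurable (f x))
    (hf : ∀ x a, |f x a| ≤ C) (φ : StatProfile G) :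
    Jfun G G.η f (ofStatAll G φ) = (1 - G.α) * ∫ x, Wv G f φ x ∂G.η := by
  rw [Jfun_tele G (ofStatAll G φ) hfm hf (abs_Wv G hf φ)]
  have : ∀ t, gap G (ofStatAll G φ) t f (Wv G f φ) = 0 := by
    intro t
    unfold gap
    refine integral_eq_zero_of_ae (ae_of_all _ fun h => ?_)
    have : jointLaw G (ofStatAll G φ) t h = lawS G φ (lastState X (JA A) t h) := rfl
    simp only [this, Pi.zero_apply]
    rw [← bellman G hf φ, sub_self]
  simp [this]

theorem jointLaw_combine (φ : StatProfile G) (i : Fin n) (σ : Strategy G i) (t : ℕ)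
    (h : Hist X (JA A) t) :
    jointLaw G (combine G (ofStatAll G φ) i σ) t h = 
      lawU G φ i (lastState X (JA A) t h) (σ.f t h) := by
  unfold jointLaw lawU combine
  congr 1
  funext j
  by_cases hj : j = i
  · subst hj; simp
  · simp [hj, ofStatAll, ofStat]

theorem lagr (hb : BoundedCosts G) (φ : StatProfile G) (i : Fin n) (σ : Strategy G i)
    (lam : Fin (l + 1) → ℝ)
    (hd : ∀ x (ν : ProbabilityMeasure (A i)), ν (G.As i x) = 1 →
      ∑ ℓ, lam ℓ * Wv G (G.c i ℓ) φ x ≤ 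
        ∑ ℓ, lam ℓ * Qv G (G.c i ℓ) (Wv G (G.c i ℓ) φ) x (lawU G φ i x ν)) :
    ∑ ℓ, lam ℓ * J G i ℓ (ofStatAll G φ) ≤ 
      ∑ ℓ, lam ℓ * J G i ℓ (combine G (ofStatAll G φ) i σ) := by
  choose C hC using hb i
  set π := combine G (ofStatAll G φ) i σ
  have e1 : ∀ ℓ, J G i ℓ (ofStatAll G φ) = (1 - G.α) * ∫ x, Wv G (G.c i ℓ) φ x ∂G.η :=
    fun ℓ => J_stat G (G.hc i ℓ) (hC ℓ) φ
  have e2 : ∀ ℓ, J G i ℓ π = (1 - G.α) * ∫ x, Wv G (G.c i ℓ) φ x ∂G.η + 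
      (1 - G.α) * ∑' t, G.α ^ t * gap G π t (G.c i ℓ) (Wv G (G.c i ℓ) φ) := fun ℓ => by
    rw [← mul_add]
    exact Jfun_tele G π (G.hc i ℓ) (hC ℓ) (abs_Wv G (hC ℓ) φ)
  have hsm : ∀ ℓ, Summable fun t => G.α ^ t * gap G π t (G.c i ℓ) (Wv G (G.c i ℓ) φ) := fun ℓ =>
    summable_disc G fun t => abs_gap G π t (hC ℓ) (abs_Wv G (hC ℓ) φ)
  have key : 0 ≤ ∑ ℓ, lam ℓ * ∑' t, G.α ^ t * gap G π t (G.c i ℓ) (Wv G (G.c i ℓ) φ) := by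
    simp_rw [← tsum_mul_left]
    rw [← Summable.tsum_finsetSum fun ℓ _ => (hsm ℓ).mul_left _]
    refine tsum_nonneg fun t => ?_
    have : ∑ ℓ, lam ℓ * (G.α ^ t * gap G π t (G.c i ℓ) (Wv G (G.c i ℓ) φ)) =
      G.α ^ t * ∑ ℓ, lam ℓ * gap G π t (G.c i ℓ) (Wv G (G.c i ℓ) φ) := by
      rw [Finset.mul_sum]; exact Finset.sum_congr rfl fun ℓ _ => by ring
    rw [this]
    refine mul_nonneg (pow_nonneg G.hα0.le t) ?_
    unfold gap
    simp_rw [← integral_const_mul]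
    rw [← integral_finsetSum]
    · refine integral_nonneg fun h => ?_
      have h1 := hd (lastState X (JA A) t h) (σ.f t h) (σ.supp t h)
      simp only [Pi.zero_apply, mul_sub, Finset.sum_sub_distrib]
      rw [jointLaw_combine]
      linarith
    · intro ℓ _
      refine Integrable.const_mul ?_ _
      refine Integrable.sub ?_ ?_
      · exact integrable_bdd _ (measurable_Qv G π t (G.hc i ℓ) (abs_Wv G (hC ℓ) φ))
          fun h => abs_Qv G (hC ℓ) (abs_Wv G (hC ℓ) φ) _ _
      · exact integrable_bdd _ ((Measurable.of_discrete (f := Wv G (G.c i ℓ) φ)).comp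
          (measurable_lastState X (JA A) t)) fun h => abs_Wv G (hC ℓ) φ _
  simp_rw [e1, e2, mul_add, Finset.sum_add_distrib]
  have : ∑ ℓ, lam ℓ * ((1 - G.α) * ∑' t, G.α ^ t * gap G π t (G.c i ℓ) (Wv G (G.c i ℓ) φ)) =
    (1 - G.α) * ∑ ℓ, lam ℓ * ∑' t, G.α ^ t * gap G π t (G.c i ℓ) (Wv G (G.c i ℓ) φ) := by
    rw [Finset.mul_sum]; exact Finset.sum_congr rfl fun ℓ _ => by ring
  rw [this]
  have := mul_nonneg (sub_nonneg.2 G.hα1.le) key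
  linarith

/-! ### Continuity -/

theorem hasSum_singletons (μ : Measure X) [IsProbabilityMeasure μ] :
    HasSum (fun y => μ.real {y}) 1 := by
  have h2 : ∑' y, μ {y} = 1 := by
    have := Measure.tsum_indicator_apply_singleton μ Set.univ MeasurableSet.univ
    simpa using this
  have h3 : HasSum (fun y => (μ {y}).toReal) (∑' y, (μ {y}).toReal) :=
    ENNReal.hasSum_toReal (by rw [h2]; simp)
  rw [← ENNReal.tsum_toReal_eq (fun y => measure_ne_top _ _), h2, ENNReal.toReal_one] at h3
  exact h3

theorem contInt {Z : Type*} [TopologicalSpace Z] (x : X) (m : Z → ∀ j, ProbabilityMeasure (A j))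
    (hm : Continuous m) (hs : ∀ z j, m z j (G.As j x) = 1) {g : JA A → ℝ}
    {C : ℝ} (hC : ∀ a, |g a| ≤ C) (hg : ContinuousOn g (jointSet G x)) :
    Continuous fun z => ∫ a, g a ∂(Measure.pi fun j => (m z j : Measure (A j))) := by
  have hcl : IsClosed (jointSet G x) := (isCompact_univ_pi fun j => G.hAs_cpt j x).isClosed
  let g0 : BoundedContinuousFunction (jointSet G x) ℝ :=
    BoundedContinuousFunction.ofNormedAddCommGroup (fun a => g a.1)
      (continuousOn_iff_continuous_domRestrict.1 hg) C (fun a => hC a.1)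
  obtain ⟨g1, -, h1⟩ := g0.exists_norm_eq_domRestrict_eq_of_closed hcl
  have h2 : ∀ a ∈ jointSet G x, g1 a = g a := fun a ha =>
    congrArg (fun u : BoundedContinuousFunction (jointSet G x) ℝ => u ⟨a, ha⟩) h1
  have h3 : ∀ z, ∫ a, g a ∂(Measure.pi fun j => (m z j : Measure (A j))) = 
      ∫ a, g1 a ∂(ProbabilityMeasure.pi (m z) : Measure (JA A)) := by
    intro z
    rw [ProbabilityMeasure.toMeasure_pi]
    refine integral_congr_ae ?_
    have hmem : ∀ᵐ a ∂(Measure.pi fun j => (m z j : Measure (A j))), a ∈ jointSet G x := by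
      refine (mem_ae_iff_prob_eq_one hcl.measurableSet).2 ?_
      unfold jointSet
      rw [Measure.pi_pi]
      refine Finset.prod_eq_one fun j _ => ?_
      rw [← ProbabilityMeasure.ennreal_coeFn_eq_coeFn_toMeasure, hs z j, ENNReal.coe_one]
    filter_upwards [hmem] with a ha
    exact (h2 a ha).symm
  simp_rw [h3]
  exact (ProbabilityMeasure.continuous_integral_boundedContinuousFunction g1).comp
    (ProbabilityMeasure.continuous_pi.comp hm)

theorem contSum {Z Y : Type*} [TopologicalSpace Z] (P w : Z → Y → ℝ) (hP0 : ∀ z y, 0 ≤ P z y)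
    (hP1 : ∀ z, HasSum (P z) 1) (hPc : ∀ y, Continuous fun z => P z y) {C : ℝ}
    (hC : ∀ z y, |w z y| ≤ C) (hw : ∀ y, Continuous fun z => w z y) :
    Continuous fun z => ∑' y, P z y * w z y := by
  rw [continuous_iff_continuousAt]
  intro z0
  have hC0 : 0 ≤ C := by
    by_contra hneg
    have hem : IsEmpty Y := ⟨fun y => hneg ((abs_nonneg _).trans (hC z0 y))⟩
    have := (hP1 z0).tsum_eq
    simp at this
  have hbd : ∀ z y, |P z y * w z y| ≤ P z y * C := fun z y => by
    rw [abs_mul, abs_of_nonneg (hP0 z y)]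
    exact mul_le_mul_of_nonneg_left (hC z y) (hP0 z y)
  have hsum : ∀ z, Summable fun y => P z y * w z y := fun z =>
    Summable.of_norm_bounded ((hP1 z).summable.mul_right C) (hbd z)
  refine continuousAt_of_locally_uniform_approx_of_continuousAt fun u hu => ?_
  obtain ⟨ε, hε, hεu⟩ := Metric.mem_uniformity_dist.1 hu
  set δ := ε / (C + 1) with hδ
  have hδ0 : 0 < δ := div_pos hε (by linarith)
  obtain ⟨F, hF⟩ := ((hP1 z0).eventually (lt_mem_nhds (show 1 - δ < 1 by linarith))).exists
  have hcF : Continuous fun z => ∑ y ∈ F, P z y := continuous_finsetSum _ fun y _ => hPc y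
  refine ⟨{z | 1 - δ < ∑ y ∈ F, P z y}, 
    (isOpen_lt continuous_const hcF).mem_nhds hF, fun z => ∑ y ∈ F, P z y * w z y, 
    (continuous_finsetSum _ fun y _ => (hPc y).mul (hw y)).continuousAt, fun z hz => hεu ?_⟩
  have hz' : 1 - δ < ∑ y ∈ F, P z y := hz
  have e1 := (hsum z).sum_add_tsum_compl (s := F)
  have e2 := (hP1 z).summable.sum_add_tsum_compl (s := F)
  rw [(hP1 z).tsum_eq] at e2
  rw [Real.dist_eq, ← e1, add_sub_cancel_left]
  have hs2 : Summable fun y : ↑((F : Set Y)ᶜ) => P z y * C := 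
    ((hP1 z).summable.mul_right C).subtype _
  have := tsum_of_norm_bounded (f := fun y : ↑((F : Set Y)ᶜ) => P z y * w z y) hs2.hasSum 
    (fun y => hbd z y)
  rw [tsum_mul_right, Real.norm_eq_abs] at this
  refine this.trans_lt ?_
  have h5 : ∑' y : ↑((F : Set Y)ᶜ), P z y < δ := by linarith
  calc _ ≤ δ * C := mul_le_mul_of_nonneg_right h5.le hC0
    _ < δ * (C + 1) := by nlinarith
    _ = ε := by rw [hδ]; field_simp

theorem contNxt (hA : AssumptionA G) {Z : Type*} [TopologicalSpace Z] (x : X)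
    (m : Z → ∀ j, ProbabilityMeasure (A j))
    (hm : Continuous m) (hs : ∀ z j, m z j (G.As j x) = 1) (w : Z → X → ℝ) {C : ℝ}
    (hC : ∀ z y, |w z y| ≤ C) (hw : ∀ y, Continuous fun z => w z y) :
    Continuous fun z => ∫ y, w z y ∂(nxt G x (Measure.pi fun j => (m z j : Measure (A j)))) := by
  have h1 : ∀ z, ∫ y, w z y ∂(nxt G x (Measure.pi fun j => (m z j : Measure (A j)))) =
      ∑' y, (nxt G x (Measure.pi fun j => (m z j : Measure (A j)))).real {y} * w z y := fun z =>
    integral_countable (integrable_bdd _ Measurable.of_discrete (hC z))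
  simp_rw [h1]
  refine contSum _ _ (fun _ _ => measureReal_nonneg) (fun z => ?_) (fun y => ?_) hC hw
  · exact hasSum_singletons _
  · have h4 : ∀ z, (nxt G x (Measure.pi fun j => (m z j : Measure (A j)))).real {y} =
        ∫ a, (G.p x a).real {y} ∂(Measure.pi fun j => (m z j : Measure (A j))) := by
      intro z
      unfold nxt
      rw [measureReal_def, Measure.bind_apply (MeasurableSet.singleton y) 
        (measurable_p G x).aemeasurable, ← integral_toReal]
      · rfl
      · exact (G.hpm x y).aemeasurable
      · exact ae_of_all _ fun a => measure_lt_top _ _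
    simp_rw [h4]
    refine contInt G x m hm hs (C := 1) (fun a => ?_) ?_
    · rw [abs_of_nonneg measureReal_nonneg]; exact measureReal_le_one
    · intro a ha
      have := hA.1 x y a ha
      exact (ENNReal.tendsto_toReal (measure_ne_top (G.p x a) {y})).comp this

theorem cont_eval (x : X) : Continuous fun (φ : StatProfile G) (j : Fin n) => (φ j).1 x := by
  refine continuous_pi fun j => ?_
  have h1 : Continuous fun φ : StatProfile G => φ j := continuous_apply j
  have h2 : Continuous fun ψ : Stat G j => ψ.1 := continuous_subtype_val
  exact (continuous_apply x).comp (h2.comp h1)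

theorem contRv (hA : AssumptionA G) {f : X → JA A → ℝ} {C : ℝ} (hf : ∀ x a, |f x a| ≤ C)
    (hfc : ∀ x, ContinuousOn (f x) (jointSet G x)) (t : ℕ) (x : X) :
    Continuous fun φ : StatProfile G => Rv G f φ t x := by
  induction t generalizing x with
  | zero =>
    exact contInt G x (fun (φ : StatProfile G) j => (φ j).1 x) (cont_eval G x) (fun φ j => (φ j).2 x) (hf x) (hfc x)
  | succ t ih =>
    exact contNxt G hA x (fun (φ : StatProfile G) j => (φ j).1 x) (cont_eval G x)
      (fun φ j => (φ j).2 x) (fun φ y => Rv G f φ t y) (fun φ y => abs_Rv G hf φ t y) ih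

theorem contWv (hA : AssumptionA G) {f : X → JA A → ℝ} {C : ℝ} (hf : ∀ x a, |f x a| ≤ C)
    (hfc : ∀ x, ContinuousOn (f x) (jointSet G x)) (x : X) :
    Continuous fun φ : StatProfile G => Wv G f φ x := by
  refine continuous_tsum (u := fun t => G.α ^ t * C) 
    (fun t => continuous_const.mul (contRv G hA hf hfc t x))
    ((summable_geometric_of_lt_one G.hα0.le G.hα1).mul_right C) fun t φ => ?_
  rw [norm_mul, norm_pow, Real.norm_of_nonneg G.hα0.le]
  exact mul_le_mul_of_nonneg_left (abs_Rv G hf φ t x) (pow_nonneg G.hα0.le t)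

theorem cont_eta {Z : Type*} [TopologicalSpace Z] (w : Z → X → ℝ) {C : ℝ}
    (hC : ∀ z y, |w z y| ≤ C) (hw : ∀ y, Continuous fun z => w z y) :
    Continuous fun z => ∫ x, w z x ∂G.η := by
  haveI := G.hη
  have h1 : ∀ z, ∫ y, w z y ∂G.η = ∑' y, G.η.real {y} * w z y := fun z =>
    integral_countable (integrable_bdd _ Measurable.of_discrete (hC z))
  simp_rw [h1]
  refine contSum _ _ (fun _ _ => measureReal_nonneg) (fun z => ?_) 
    (fun y => continuous_const) hC hw
  exact hasSum_singletons _

theorem contQ (hA : AssumptionA G) {f : X → JA A → ℝ} {C : ℝ} (hf : ∀ x a, |f x a| ≤ C)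
    (hfc : ∀ x, ContinuousOn (f x) (jointSet G x)) (i : Fin n) (x : X) 
    (ν : ProbabilityMeasure (A i)) (hν : ν (G.As i x) = 1) :
    Continuous fun φ : StatProfile G => Qv G f (Wv G f φ) x (lawU G φ i x ν) := by
  have hcm : Continuous fun (φ : StatProfile G) => 
      (Function.update (fun j => (φ j).1 x) i ν : ∀ j, ProbabilityMeasure (A j)) := by
    refine Continuous.update ?_ i continuous_const
    exact cont_eval G x
  have hs : ∀ (φ : StatProfile G) j, 
      (Function.update (fun j => (φ j).1 x) i ν : ∀ j, ProbabilityMeasure (A j)) j (G.As j x) = 1 := by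
    intro φ j
    by_cases hj : j = i
    · subst hj; simpa using hν
    · rw [Function.update_of_ne hj]; exact (φ j).2 x
  exact (contInt G x _ hcm hs (hf x) (hfc x)).add (continuous_const.mul 
    (contNxt G hA x _ hcm hs (fun φ => Wv G f φ) (fun φ => abs_Wv G hf φ) (contWv G hA hf hfc)))

/-! ### Compactness and mixing -/

theorem coe_eq_one_iff {Ω : Type*} [MeasurableSpace Ω] (μ : ProbabilityMeasure Ω) (s : Set Ω) :
    μ s = 1 ↔ (μ : Measure Ω) s = 1 := by
  rw [← ProbabilityMeasure.ennreal_coeFn_eq_coeFn_toMeasure, ENNReal.coe_eq_one]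

theorem compact_supp (i : Fin n) (x : X) :
    IsCompact {μ : ProbabilityMeasure (A i) | μ (G.As i x) = 1} := by
  have h := isCompact_setOfPred_probabilityMeasure_mass_eq_compl_isCompact_le
    (E := A i) (u := fun _ => 0) (K := fun _ => G.As i x) tendsto_const_nhds
    (fun _ => G.hAs_cpt i x) (Or.inr monotone_const)
  convert h using 1
  ext μ
  have hm : MeasurableSet (G.As i x) := (G.hAs_cpt i x).isClosed.measurableSet
  simp only [Set.mem_setOf_eq, forall_const, nonpos_iff_eq_zero]
  rw [coe_eq_one_iff, ← prob_compl_eq_zero_iff hm, 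
    ← ProbabilityMeasure.ennreal_coeFn_eq_coeFn_toMeasure, ENNReal.coe_eq_zero]

instance compact_Stat (i : Fin n) : CompactSpace (Stat G i) := by
  have h := isCompact_univ_pi fun x => compact_supp G i x
  have h2 : IsCompact {φ : X → ProbabilityMeasure (A i) | ∀ x, φ x (G.As i x) = 1} := by
    convert h using 1
    ext φ
    simp [Set.mem_pi]
  exact isCompact_iff_compactSpace.1 h2

instance nonempty_Stat (i : Fin n) : Nonempty (Stat G i) := by
  choose a ha using fun x => G.hAs_ne i x
  refine ⟨⟨fun x => ⟨Measure.dirac (a x), inferInstance⟩, fun x => ?_⟩⟩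
  exact (coe_eq_one_iff (⟨Measure.dirac (a x), inferInstance⟩ : ProbabilityMeasure (A i)) _).2
    (Measure.dirac_apply_of_mem (ha x))

theorem simplex_ofReal_sum {m : ℕ} (t : stdSimplex ℝ (Fin m)) :
    ∑ j, ENNReal.ofReal (t.1 j) = 1 := by
  rw [← ENNReal.ofReal_sum_of_nonneg (fun j _ => t.2.1 j), t.2.2, ENNReal.ofReal_one]

/-- Mixture of probability measures. -/
noncomputable def mix {Ω : Type*} [MeasurableSpace Ω] {m : ℕ} (t : stdSimplex ℝ (Fin m)) 
    (ψ : Fin m → ProbabilityMeasure Ω) : ProbabilityMeasure Ω :=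
  ⟨∑ j, ENNReal.ofReal (t.1 j) • (ψ j : Measure Ω), ⟨by
    simp [Measure.finset_sum_apply, simplex_ofReal_sum]⟩⟩

theorem mix_apply {Ω : Type*} [MeasurableSpace Ω] {m : ℕ} (t : stdSimplex ℝ (Fin m)) 
    (ψ : Fin m → ProbabilityMeasure Ω) (s : Set Ω) : 
    (mix t ψ : Measure Ω) s = ∑ j, ENNReal.ofReal (t.1 j) * (ψ j : Measure Ω) s := by
  change (∑ j, ENNReal.ofReal (t.1 j) • (ψ j : Measure Ω)) s = _
  simp [Measure.finset_sum_apply]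

theorem mix_supp {Ω : Type*} [MeasurableSpace Ω] {m : ℕ} (t : stdSimplex ℝ (Fin m)) 
    (ψ : Fin m → ProbabilityMeasure Ω) (s : Set Ω) (h : ∀ j, ψ j s = 1) : mix t ψ s = 1 := by
  rw [coe_eq_one_iff, mix_apply]
  simp_rw [fun j => (coe_eq_one_iff (ψ j) s).1 (h j), mul_one]
  exact simplex_ofReal_sum t

theorem integral_mixture {Ω : Type*} [MeasurableSpace Ω] {m : ℕ} (t : stdSimplex ℝ (Fin m)) 
    (ψ : Fin m → Measure Ω) [∀ j, IsProbabilityMeasure (ψ j)] {f : Ω → ℝ} (hf : Measurable f) 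
    {C : ℝ} (hC : ∀ x, |f x| ≤ C) :
    ∫ x, f x ∂(∑ j, ENNReal.ofReal (t.1 j) • ψ j) = ∑ j, t.1 j * ∫ x, f x ∂(ψ j) := by
  rw [integral_finsetSum_measure]
  · refine Finset.sum_congr rfl fun j _ => ?_
    rw [integral_smul_measure, ENNReal.toReal_ofReal (t.2.1 j), smul_eq_mul]
  · exact fun j _ => (integrable_bdd _ hf hC).smul_measure ENNReal.ofReal_ne_top

theorem continuous_coord {m : ℕ} (j : Fin m) : 
    Continuous fun t : stdSimplex ℝ (Fin m) => t.1 j :=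
  (continuous_apply j).comp continuous_subtype_val

theorem continuous_mix {Ω : Type*} [MeasurableSpace Ω] [TopologicalSpace Ω] [BorelSpace Ω] 
    {m : ℕ} (ψ : Fin m → ProbabilityMeasure Ω) :
    Continuous fun t : stdSimplex ℝ (Fin m) => mix t ψ := by
  rw [ProbabilityMeasure.continuous_iff_forall_continuous_integral]
  intro f
  have : ∀ t : stdSimplex ℝ (Fin m), ∫ ω, f ω ∂(mix t ψ : Measure Ω) = 
      ∑ j, t.1 j * ∫ x, f x ∂(ψ j : Measure Ω) := fun t =>
    integral_mixture t (fun j => (ψ j : Measure Ω)) f.continuous.measurable (C := ‖f‖) 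
      (fun x => f.norm_coe_le_norm x)
  simp_rw [this]
  exact continuous_finsetSum _ fun j _ => (continuous_coord j).mul continuous_const

theorem lawU_mix (φ : StatProfile G) (i : Fin n) (x : X) {m : ℕ} (t : stdSimplex ℝ (Fin m)) 
    (ψ : Fin m → ProbabilityMeasure (A i)) :
    lawU G φ i x (mix t ψ) = ∑ j, ENNReal.ofReal (t.1 j) • lawU G φ i x (ψ j) := by
  unfold lawU
  refine Measure.pi_eq fun s _ => ?_
  simp only [Measure.finset_sum_apply, Measure.smul_apply, Measure.pi_pi, smul_eq_mul]
  have key : ∀ ν : ProbabilityMeasure (A i), ∏ k, ((Function.update (fun k => (φ k).1 x) i ν k : 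
      ProbabilityMeasure (A k)) : Measure (A k)) (s k) = 
      (ν : Measure (A i)) (s i) * 
        ∏ k ∈ Finset.univ.erase i, ((φ k).1 x : Measure (A k)) (s k) := by
    intro ν
    rw [← Finset.mul_prod_erase Finset.univ _ (Finset.mem_univ i), Function.update_self]
    congr 1
    refine Finset.prod_congr rfl fun k hk => ?_
    rw [Function.update_of_ne (Finset.ne_of_mem_erase hk)]
  simp_rw [key, mix_apply, Finset.sum_mul, mul_assoc]

theorem Qv_eq {f : X → JA A → ℝ} {W : X → ℝ} {C C' : ℝ} (hfm : ∀ x, Measurable (f x))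
    (hf : ∀ x a, |f x a| ≤ C) (hW : ∀ x, |W x| ≤ C') (x : X) (ν : Measure (JA A)) 
    [IsProbabilityMeasure ν] :
    Qv G f W x ν = ∫ a, (f x a + G.α * ∫ y, W y ∂(G.p x a)) ∂ν := by
  unfold Qv
  rw [int_nxt G W hW, integral_add, integral_const_mul]
  · exact integrable_bdd _ (hfm x) (hf x)
  · exact (integrable_bdd _ (measurable_int_p G W x) (C := C') 
      fun a => abs_integral_bdd _ hW).const_mul _

theorem Qv_mix {f : X → JA A → ℝ} {W : X → ℝ} {C C' : ℝ} (hfm : ∀ x, Measurable (f x))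
    (hf : ∀ x a, |f x a| ≤ C) (hW : ∀ x, |W x| ≤ C') (φ : StatProfile G) (i : Fin n) (x : X)
    {m : ℕ} (t : stdSimplex ℝ (Fin m)) (ψ : Fin m → ProbabilityMeasure (A i)) :
    Qv G f W x (lawU G φ i x (mix t ψ)) = ∑ j, t.1 j * Qv G f W x (lawU G φ i x (ψ j)) := by
  simp_rw [Qv_eq G hfm hf hW]
  rw [lawU_mix]
  refine integral_mixture t (fun j => lawU G φ i x (ψ j)) 
    ((hfm x).add ((measurable_int_p G W x).const_mul _)) (C := C + G.α * C') fun a => ?_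
  refine (abs_add_le _ _).trans (add_le_add (hf x a) ?_)
  rw [abs_mul, abs_of_pos G.hα0]
  exact mul_le_mul_of_nonneg_left (abs_integral_bdd _ hW) G.hα0.le

/-! ### The Ky Fan function -/

/-- One-shot Lagrangian gap of player `i` at state `x`. -/
noncomputable def Dg (i : Fin n) (φ : StatProfile G) (lam : Fin (l + 1) → ℝ) (x : X) 
    (ν : ProbabilityMeasure (A i)) : ℝ :=
  ∑ ℓ, lam ℓ * (Wv G (G.c i ℓ) φ x - Qv G (G.c i ℓ) (Wv G (G.c i ℓ) φ) x (lawU G φ i x ν))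

/-- Constraint slack (zero for the objective). -/
noncomputable def gs (i : Fin n) (φ : StatProfile G) (ℓ : Fin (l + 1)) : ℝ :=
  if ℓ = 0 then 0 else (1 - G.α) * ∫ x, Wv G (G.c i ℓ) φ x ∂G.η - G.κ i ℓ

/-- Domain of the variational inequality. -/
abbrev KK : Type _ := StatProfile G × (Fin n → stdSimplex ℝ (Fin (l + 1)))

/-- The Ky Fan function. -/
noncomputable def FF (u v : KK G) : ℝ :=
  ∑ i, (∫ x, Dg G i u.1 (u.2 i).1 x ((v.1 i).1 x) ∂G.η + 
    ∑ ℓ, ((v.2 i).1 ℓ - (u.2 i).1 ℓ) * gs G i u.1 ℓ)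

theorem Dg_self (hb : BoundedCosts G) (i : Fin n) (φ : StatProfile G) (lam : Fin (l + 1) → ℝ)
    (x : X) : Dg G i φ lam x ((φ i).1 x) = 0 := by
  choose C hC using hb i
  unfold Dg
  refine Finset.sum_eq_zero fun ℓ _ => ?_
  rw [lawU_self, ← bellman G (hC ℓ) φ, sub_self, mul_zero]

theorem Dg_bdd (hb : BoundedCosts G) (i : Fin n) : ∃ B : ℝ, ∀ (φ : StatProfile G) 
    (lam : stdSimplex ℝ (Fin (l + 1))) (x : X) (ν : ProbabilityMeasure (A i)),
    |Dg G i φ lam.1 x ν| ≤ B := by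
  choose C hC using hb i
  refine ⟨∑ ℓ, ((1 - G.α)⁻¹ * C ℓ + (C ℓ + G.α * ((1 - G.α)⁻¹ * C ℓ))), fun φ lam x ν => ?_⟩
  refine (Finset.abs_sum_le_sum_abs _ _).trans (Finset.sum_le_sum fun ℓ _ => ?_)
  rw [abs_mul]
  have h1 : |lam.1 ℓ| ≤ 1 := by
    rw [abs_of_nonneg (lam.2.1 ℓ), ← lam.2.2]
    exact Finset.single_le_sum (fun k _ => lam.2.1 k) (Finset.mem_univ ℓ)
  have h2 := (abs_sub (Wv G (G.c i ℓ) φ x) (Qv G (G.c i ℓ) (Wv G (G.c i ℓ) φ) x 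
    (lawU G φ i x ν))).trans (add_le_add (abs_Wv G (hC ℓ) φ x) 
      (abs_Qv G (hC ℓ) (abs_Wv G (hC ℓ) φ) x (lawU G φ i x ν)))
  exact (mul_le_of_le_one_left (abs_nonneg _) h1).trans h2

theorem Dg_mix (hb : BoundedCosts G) (i : Fin n) (φ : StatProfile G) (lam : Fin (l + 1) → ℝ)
    (x : X) {m : ℕ} (t : stdSimplex ℝ (Fin m)) (ψ : Fin m → ProbabilityMeasure (A i)) :
    ∑ j, t.1 j * Dg G i φ lam x (ψ j) = Dg G i φ lam x (mix t ψ) := by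
  choose C hC using hb i
  unfold Dg
  simp_rw [Finset.mul_sum]
  rw [Finset.sum_comm]
  refine Finset.sum_congr rfl fun ℓ _ => ?_
  rw [Qv_mix G (G.hc i ℓ) (hC ℓ) (abs_Wv G (hC ℓ) φ)]
  have : Wv G (G.c i ℓ) φ x = ∑ j, t.1 j * Wv G (G.c i ℓ) φ x := by
    rw [← Finset.sum_mul, t.2.2, one_mul]
  conv_rhs => rw [this, ← Finset.sum_sub_distrib, Finset.mul_sum]
  exact Finset.sum_congr rfl fun j _ => by ring

theorem FF_cont (hA : AssumptionA G) (hb : BoundedCosts G) (v : KK G) :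
    Continuous fun u => FF G u v := by
  unfold FF
  refine continuous_finsetSum _ fun i _ => ?_
  have hcl : ∀ ℓ, Continuous fun u : KK G => (u.2 i).1 ℓ := fun ℓ =>
    (continuous_coord ℓ).comp ((continuous_apply i).comp continuous_snd)
  obtain ⟨B, hB⟩ := Dg_bdd G hb i
  choose C hC using hb i
  refine Continuous.add ?_ ?_
  · refine cont_eta G (fun (u : KK G) x => Dg G i u.1 (u.2 i).1 x ((v.1 i).1 x)) 
      (fun u x => hB _ _ _ _) fun x => ?_
    unfold Dg
    refine continuous_finsetSum _ fun ℓ _ => (hcl ℓ).mul (Continuous.sub ?_ ?_)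
    · exact (contWv G hA (hC ℓ) (hA.2 i ℓ) x).comp continuous_fst
    · exact (contQ G hA (hC ℓ) (hA.2 i ℓ) i x _ ((v.1 i).2 x)).comp continuous_fst
  · refine continuous_finsetSum _ fun ℓ _ => (continuous_const.sub (hcl ℓ)).mul ?_
    unfold gs
    by_cases h0 : ℓ = 0
    · simp only [h0, if_true]; exact continuous_const
    · simp only [h0, if_false]
      refine (continuous_const.mul ?_).sub continuous_const
      exact (cont_eta G (fun φ x => Wv G (G.c i ℓ) φ x) (fun φ x => abs_Wv G (hC ℓ) φ x)
        (contWv G hA (hC ℓ) (hA.2 i ℓ))).comp continuous_fst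

theorem FF_conv (hb : BoundedCosts G) (m : ℕ) (y : Fin (m + 1) → KK G) :
    ∃ e : stdSimplex ℝ (Fin (m + 1)) → KK G,
      Continuous e ∧ ∀ t, ∑ j, t.1 j * FF G (e t) (y j) ≤ 0 := by
  let e : stdSimplex ℝ (Fin (m + 1)) → KK G := fun t =>
    (fun i => ⟨fun x => mix t (fun j => ((y j).1 i).1 x), 
      fun x => mix_supp t _ _ fun j => ((y j).1 i).2 x⟩,
     fun i => ⟨∑ j, t.1 j • ((y j).2 i).1, (convex_stdSimplex ℝ _).sum_mem (fun j _ => t.2.1 j) 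
      t.2.2 (fun j _ => ((y j).2 i).2)⟩)
  have he1 : ∀ t i x, ((e t).1 i).1 x = mix t (fun j => ((y j).1 i).1 x) := fun _ _ _ => rfl
  have he2 : ∀ t i ℓ, ((e t).2 i).1 ℓ = ∑ j, t.1 j * ((y j).2 i).1 ℓ := fun t i ℓ => by
    simp [e, Finset.sum_apply]
  refine ⟨e, ?_, fun t => le_of_eq ?_⟩
  · refine Continuous.prodMk ?_ ?_
    · refine continuous_pi fun i => Continuous.subtype_mk ?_ _
      exact continuous_pi fun x => continuous_mix _
    · refine continuous_pi fun i => Continuous.subtype_mk ?_ _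
      exact continuous_finsetSum _ fun j _ => (continuous_coord j).smul continuous_const
  · haveI := G.hη
    unfold FF
    simp_rw [Finset.mul_sum]
    rw [Finset.sum_comm]
    refine Finset.sum_eq_zero fun i _ => ?_
    obtain ⟨B, hB⟩ := Dg_bdd G hb i
    simp_rw [mul_add, Finset.sum_add_distrib]
    have h1 : ∑ j, t.1 j * ∫ x, Dg G i (e t).1 ((e t).2 i).1 x (((y j).1 i).1 x) ∂G.η = 0 := by
      simp_rw [← integral_const_mul]
      rw [← integral_finsetSum _ fun j _ => 
        (integrable_bdd _ Measurable.of_discrete (fun x => hB _ _ _ _)).const_mul _]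
      refine integral_eq_zero_of_ae (ae_of_all _ fun x => ?_)
      simp only [Pi.zero_apply]
      rw [Dg_mix G hb, ← he1]
      exact Dg_self G hb _ _ _ _
    have h2 : ∑ j, t.1 j * ∑ ℓ, (((y j).2 i).1 ℓ - ((e t).2 i).1 ℓ) * gs G i (e t).1 ℓ = 0 := by
      simp_rw [Finset.mul_sum]
      rw [Finset.sum_comm]
      refine Finset.sum_eq_zero fun ℓ _ => ?_
      simp_rw [← mul_assoc, mul_sub]
      rw [← Finset.sum_mul, Finset.sum_sub_distrib, ← Finset.sum_mul, t.2.2, one_mul, he2, sub_self,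
        zero_mul]
    rw [h1, h2, add_zero]

theorem exists_vi (hA : AssumptionA G) (hb : BoundedCosts G) :
    ∃ u : KK G, ∀ v, FF G u v ≤ 0 :=
  ScarfB.ky_fan (FF G) (FF_cont G hA hb) (FF_conv G hb)

theorem vi_state (hb : BoundedCosts G) (hD : AssumptionD G) (u : KK G) (hu : ∀ v, FF G u v ≤ 0)
    (i : Fin n) (x : X) (ν : ProbabilityMeasure (A i)) (hν : ν (G.As i x) = 1) :
    Dg G i u.1 (u.2 i).1 x ν ≤ 0 := by
  classical
  haveI := G.hη
  let γ : Stat G i := ⟨Function.update (u.1 i).1 x ν, fun y => by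
    by_cases hy : y = x
    · subst hy; simpa using hν
    · rw [Function.update_of_ne hy]; exact (u.1 i).2 y⟩
  have h := hu (Function.update u.1 i γ, u.2)
  unfold FF at h
  simp only [sub_self, zero_mul, Finset.sum_const_zero, add_zero] at h
  rw [Finset.sum_eq_single i] at h
  · rw [Function.update_self] at h
    obtain ⟨B, hB⟩ := Dg_bdd G hb i
    rw [integral_countable (integrable_bdd _ Measurable.of_discrete (fun x => hB _ _ _ _)),
      tsum_eq_single x] at h
    · have e : γ.1 x = ν := by
        change Function.update (u.1 i).1 x ν x = ν
        exact Function.update_self _ _ _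
      rw [e, smul_eq_mul] at h
      have hpos : 0 < G.η.real {x} := ENNReal.toReal_pos (hD x).ne' (measure_ne_top _ _)
      exact nonpos_of_mul_nonpos_right h hpos
    · intro y hy
      have e : γ.1 y = (u.1 i).1 y := Function.update_of_ne hy _ _
      rw [e, Dg_self G hb, smul_zero]
  · intro k _ hk
    rw [Function.update_of_ne hk]
    simp_rw [Dg_self G hb]
    simp
  · intro h; exact absurd (Finset.mem_univ i) h

theorem vi_simplex (hb : BoundedCosts G) (u : KK G) (hu : ∀ v, FF G u v ≤ 0)
    (i : Fin n) (ℓ₀ : Fin (l + 1)) : 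
    gs G i u.1 ℓ₀ ≤ ∑ ℓ, (u.2 i).1 ℓ * gs G i u.1 ℓ := by
  classical
  let e : stdSimplex ℝ (Fin (l + 1)) := ⟨Pi.single ℓ₀ 1, single_mem_stdSimplex ℝ ℓ₀⟩
  have h := hu (u.1, Function.update u.2 i e)
  unfold FF at h
  simp_rw [Dg_self G hb] at h
  simp only [integral_zero, zero_add] at h
  rw [Finset.sum_eq_single i] at h
  · rw [Function.update_self] at h
    simp_rw [sub_mul, Finset.sum_sub_distrib] at h
    have e1 : ∑ ℓ, e.1 ℓ * gs G i u.1 ℓ = gs G i u.1 ℓ₀ := by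
      simp [e, Pi.single_apply]
    rw [e1] at h
    linarith
  · intro k _ hk
    rw [Function.update_of_ne hk]
    simp
  · intro h; exact absurd (Finset.mem_univ i) h

/-- Proposition 1. -/
theorem stmt13 (hA : AssumptionA G) (hC : AssumptionC G) (hD : AssumptionD G)
    (hb : BoundedCosts G) :
    ∃ φ : StatProfile G, IsNashStat G φ := by
  obtain ⟨u, hu⟩ := exists_vi G hA hb
  obtain ⟨φ, lam⟩ := u
  have hgs : ∀ i ℓ, ℓ ≠ 0 → gs G i φ ℓ = J G i ℓ (ofStatAll G φ) - G.κ i ℓ := by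
    intro i ℓ hℓ
    obtain ⟨C, hCb⟩ := hb i ℓ
    unfold gs
    rw [if_neg hℓ]
    congr 1
    exact (J_stat G (G.hc i ℓ) hCb φ).symm
  have hg0 : ∀ i, gs G i φ 0 = 0 := fun i => if_pos rfl
  have hv : ∀ i ℓ, gs G i φ ℓ ≤ ∑ k, (lam i).1 k * gs G i φ k := fun i ℓ =>
    vi_simplex G hb (φ, lam) hu i ℓ
  have hL : ∀ i (σ : Strategy G i), ∑ ℓ, (lam i).1 ℓ * J G i ℓ (ofStatAll G φ) ≤ 
      ∑ ℓ, (lam i).1 ℓ * J G i ℓ (combine G (ofStatAll G φ) i σ) := by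
    intro i σ
    refine lagr G hb φ i σ _ fun x ν hν => ?_
    have := vi_state G hb hD (φ, lam) hu i x ν hν
    unfold Dg at this
    simp only [mul_sub, Finset.sum_sub_distrib] at this
    linarith
  have hnn : ∀ i ℓ, 0 ≤ (lam i).1 ℓ := fun i ℓ => (lam i).2.1 ℓ
  have hsum : ∀ i, (lam i).1 0 + ∑ k : Fin l, (lam i).1 k.succ = 1 := fun i => by
    rw [← Fin.sum_univ_succ]; exact (lam i).2.2
  have hvs : ∀ i, ∑ k, (lam i).1 k * gs G i φ k = 
      ∑ k : Fin l, (lam i).1 k.succ * (J G i k.succ (ofStatAll G φ) - G.κ i k.succ) := fun i => by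
    rw [Fin.sum_univ_succ, hg0, mul_zero, zero_add]
    exact Finset.sum_congr rfl fun k _ => by rw [hgs i _ (Fin.succ_ne_zero k)]
  have hv0 : ∀ i, 0 ≤ ∑ k, (lam i).1 k * gs G i φ k := fun i => by
    have := hv i 0; rwa [hg0] at this
  have hL2 : ∀ i (σ : Strategy G i), (lam i).1 0 * J G i 0 (ofStatAll G φ) + 
      ∑ k, (lam i).1 k * gs G i φ k ≤ (lam i).1 0 * J G i 0 (combine G (ofStatAll G φ) i σ) + 
      ∑ k : Fin l, (lam i).1 k.succ * 
        (J G i k.succ (combine G (ofStatAll G φ) i σ) - G.κ i k.succ) := by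
    intro i σ
    have := hL i σ
    rw [Fin.sum_univ_succ, Fin.sum_univ_succ] at this
    rw [hvs]
    simp only [mul_sub, Finset.sum_sub_distrib]
    linarith
  have hpos : ∀ i, 0 < (lam i).1 0 := by
    intro i
    by_contra hneg
    have h0 : (lam i).1 0 = 0 := le_antisymm (not_lt.1 hneg) (hnn i 0)
    obtain ⟨σ, hσ⟩ := hC φ i
    have h1 := hL2 i σ
    rw [h0] at h1
    have h2 := hsum i
    rw [h0, zero_add] at h2
    have h3 : ∃ k : Fin l, 0 < (lam i).1 k.succ := by
      by_contra hno
      push Not at hno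
      have : ∑ k : Fin l, (lam i).1 k.succ ≤ 0 := Finset.sum_nonpos fun k _ => hno k
      linarith
    obtain ⟨k, hk⟩ := h3
    have h4 : ∑ k : Fin l, (lam i).1 k.succ * 
        (J G i k.succ (combine G (ofStatAll G φ) i σ) - G.κ i k.succ) < 0 := by
      refine Finset.sum_neg' (fun k _ => ?_) ⟨k, Finset.mem_univ k, ?_⟩
      · exact mul_nonpos_of_nonneg_of_nonpos (hnn i _) 
          (sub_nonpos.2 (hσ _ (Fin.succ_ne_zero k)).le)
      · exact mul_neg_of_pos_of_neg hk (sub_neg.2 (hσ _ (Fin.succ_ne_zero k)))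
    have := hv0 i
    linarith
  have hvz : ∀ i, ∑ k, (lam i).1 k * gs G i φ k = 0 := by
    intro i
    set v := ∑ k, (lam i).1 k * gs G i φ k with hvdef
    have h1 : ∑ k : Fin l, (lam i).1 k.succ * gs G i φ k.succ ≤ 
        ∑ k : Fin l, (lam i).1 k.succ * v := 
      Finset.sum_le_sum fun k _ => mul_le_mul_of_nonneg_left (hv i _) (hnn i _)
    have h2 : v = ∑ k : Fin l, (lam i).1 k.succ * gs G i φ k.succ := by
      rw [hvdef, Fin.sum_univ_succ, hg0, mul_zero, zero_add]
    rw [← h2, ← Finset.sum_mul] at h1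
    have h3 := hsum i
    have h4 := hpos i
    have h5 := hv0 i
    have h6 : ∑ k : Fin l, (lam i).1 k.succ = 1 - (lam i).1 0 := by linarith
    rw [h6] at h1
    have h7 : (lam i).1 0 * v ≤ 0 := by nlinarith
    exact le_antisymm (nonpos_of_mul_nonpos_right h7 h4) h5
  refine ⟨φ, fun i ℓ hℓ => ?_, fun i σ hσ => ?_⟩
  · have := hv i ℓ
    rw [hvz, hgs i ℓ hℓ] at this
    linarith
  · have h1 := hL2 i σ
    rw [hvz] at h1
    have h2 : ∑ k : Fin l, (lam i).1 k.succ * 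
        (J G i k.succ (combine G (ofStatAll G φ) i σ) - G.κ i k.succ) ≤ 0 :=
      Finset.sum_nonpos fun k _ => mul_nonpos_of_nonneg_of_nonpos (hnn i _) 
          (sub_nonpos.2 (hσ _ (Fin.succ_ne_zero k)))
    exact le_of_mul_le_mul_left (by linarith) (hpos i)


end CSGame
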